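/- arXiv:2510.03554 — 8 statements merged into one kernel-verified Lean document; each statement's English description precedes it below -/
import Mathlib

section
/- Let G be a finite simple graph of order 2n and let k be an integer with 2 ≤ k ≤ n−1. If G is k-extendable, then G is (k−1)-extendable. -/
open SimpleGraph

/-- A graph `G` is `k`-extendable if it is connected, has a perfect matching, and every
matching of size `k` is contained in a perfect matching. -/
def KExt {V : Type*} [Fintype V] (G : SimpleGraph V) (k : ℕ) : Prop :=
  G.Connected ∧ (∃ P : G.Subgraph, P.IsPerfectMatching) ∧
    ∀ M : G.Subgraph, M.IsMatching → M.edgeSet.ncard = k →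
      ∃ P : G.Subgraph, P.IsPerfectMatching ∧ M ≤ P

/-- The subgraph of `G` whose edges are exactly those of `T` and whose vertices are their ends. -/
def subgraphOfEdges {V : Type*} (G : SimpleGraph V) (T : Set (Sym2 V)) (hT : T ⊆ G.edgeSet) :
    G.Subgraph where
  verts := {v | ∃ w, s(v, w) ∈ T}
  Adj v w := s(v, w) ∈ T
  adj_sub h := hT h
  edge_vert h := ⟨_, h⟩
  symm := ⟨fun v w h => by rwa [Sym2.eq_swap]⟩

theorem edgeSet_subgraphOfEdges {V : Type*} (G : SimpleGraph V) (T : Set (Sym2 V))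
    (hT : T ⊆ G.edgeSet) : (subgraphOfEdges G T hT).edgeSet = T := by
  ext e
  induction e with
  | _ a b => rfl

theorem isMatching_subgraphOfEdges {V : Type*} (G : SimpleGraph V) (T : Set (Sym2 V))
    (hT : T ⊆ G.edgeSet) (h : ∀ v w w', s(v, w) ∈ T → s(v, w') ∈ T → w = w') :
    (subgraphOfEdges G T hT).IsMatching := by
  rintro v ⟨w, hw⟩
  exact ⟨w, hw, fun w' hw' => h v w' w hw' hw⟩

theorem SimpleGraph.Subgraph.IsMatching.le_of_edgeSet_subset {V : Type*} {G : SimpleGraph V}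
    {M P : G.Subgraph} (hM : M.IsMatching) (h : M.edgeSet ⊆ P.edgeSet) : M ≤ P := by
  have hadj : ∀ ⦃v w⦄, M.Adj v w → P.Adj v w := fun v w hvw => h (a := s(v, w)) hvw
  refine ⟨fun v hv => ?_, hadj⟩
  obtain ⟨w, hw, -⟩ := hM hv
  exact P.edge_vert (hadj hw)

theorem SimpleGraph.Subgraph.IsPerfectMatching.two_mul_ncard_edgeSet {V : Type*} [Fintype V]
    {G : SimpleGraph V} {P : G.Subgraph} (hP : P.IsPerfectMatching) :
    2 * P.edgeSet.ncard = Fintype.card V := by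
  classical
  have h := P.spanningCoe.sum_degrees_eq_twice_card_edges
  have hd : ∀ v, P.spanningCoe.degree v = 1 := fun v => by
    rw [Subgraph.degree_spanningCoe]
    exact Subgraph.isPerfectMatching_iff_forall_degree.mp hP v
  simp only [hd, Finset.sum_const, Finset.card_univ, smul_eq_mul, mul_one] at h
  rw [h, ← Subgraph.edgeSet_spanningCoe, ← coe_edgeFinset, Set.ncard_coe_finset]

/-- If every matching with `m + 1` edges extends to a perfect matching, then a perfect matching
not containing a given matching `M` with `m` edges can be traded for one sharing more edges
with `M`. -/
theorem exists_isPerfectMatching_ncard_inter_lt {V : Type*} [Fintype V] {G : SimpleGraph V}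
    {m : ℕ} (hcard : 2 * (m + 2) ≤ Fintype.card V)
    (hext : ∀ M : G.Subgraph, M.IsMatching → M.edgeSet.ncard = m + 1 →
      ∃ P : G.Subgraph, P.IsPerfectMatching ∧ M ≤ P)
    {M P : G.Subgraph} (hM : M.IsMatching) (hMm : M.edgeSet.ncard = m)
    (hP : P.IsPerfectMatching) (hMP : ¬ M.edgeSet ⊆ P.edgeSet) :
    ∃ Q : G.Subgraph, Q.IsPerfectMatching ∧
      (P.edgeSet ∩ M.edgeSet).ncard < (Q.edgeSet ∩ M.edgeSet).ncard := by
  obtain ⟨e, heM, heP⟩ := Set.not_subset.mp hMP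
  induction e with
  | _ a b =>
  have hab : M.Adj a b := heM
  have hPe := hP.two_mul_ncard_edgeSet
  obtain ⟨a', ha', -⟩ := hP.1 (hP.2 a)
  obtain ⟨b', hb', -⟩ := hP.1 (hP.2 b)
  have hU : m ≤ (P.edgeSet \ {s(a, a'), s(b, b')}).ncard := by
    have h1 := Set.le_ncard_sdiff {s(a, a'), s(b, b')} P.edgeSet
    have h2 := Set.ncard_insert_le s(a, a') {s(b, b')}
    rw [Set.ncard_singleton] at h2
    omega
  have hsub : P.edgeSet ∩ M.edgeSet ⊆ P.edgeSet \ {s(a, a'), s(b, b')} := by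
    rintro f ⟨hfP, hfM⟩
    refine ⟨hfP, ?_⟩
    rintro (rfl | rfl)
    · obtain rfl : a' = b := hM.eq_of_adj_left (u := a) hfM hab
      exact heP hfP
    · obtain rfl : b' = a := hM.eq_of_adj_left (u := b) hfM hab.symm
      exact heP (P.adj_symm hfP)
  obtain ⟨T, hT1, hT2, hTc⟩ := Set.exists_subsuperset_card_eq hsub
    (hMm ▸ Set.ncard_le_ncard Set.inter_subset_right) hU
  have heT : s(a, b) ∉ T := fun h => heP (hT2 h).1
  have hTP : ∀ {v w}, s(v, w) ∈ T → P.Adj v w := fun h => (hT2 h).1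
  have haT : ∀ w, s(a, w) ∉ T := fun w h =>
    (hT2 h).2 (by simp [hP.1.eq_of_adj_left (hTP h) ha'])
  have hbT : ∀ w, s(b, w) ∉ T := fun w h =>
    (hT2 h).2 (by simp [hP.1.eq_of_adj_left (hTP h) hb'])
  have hG : insert s(a, b) T ⊆ G.edgeSet := by
    rintro f (rfl | hf)
    · exact hab.adj_sub
    · exact P.edgeSet_subset (hT2 hf).1
  have hN : (subgraphOfEdges G _ hG).IsMatching := by
    apply isMatching_subgraphOfEdges
    rintro v w w' (h | h) (h' | h')
    · exact Sym2.congr_right.mp (h.trans h'.symm)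
    · rcases Sym2.eq_iff.mp h with ⟨rfl, -⟩ | ⟨rfl, -⟩
      exacts [(haT _ h').elim, (hbT _ h').elim]
    · rcases Sym2.eq_iff.mp h' with ⟨rfl, -⟩ | ⟨rfl, -⟩
      exacts [(haT _ h).elim, (hbT _ h).elim]
    · exact hP.1.eq_of_adj_left (hTP h) (hTP h')
  obtain ⟨Q, hQ, hNQ⟩ := hext _ hN (by
    rw [edgeSet_subgraphOfEdges, Set.ncard_insert_of_notMem heT, hTc])
  have hTQ : insert s(a, b) T ⊆ Q.edgeSet :=
    edgeSet_subgraphOfEdges G _ hG ▸ Subgraph.edgeSet_mono hNQ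
  have hPQ : P.edgeSet ∩ M.edgeSet ⊆ Q.edgeSet ∩ M.edgeSet := fun f hf =>
    ⟨hTQ (Or.inr (hT1 hf)), hf.2⟩
  exact ⟨Q, hQ, Set.ncard_lt_ncard ((Set.ssubset_iff_of_subset hPQ).mpr
    ⟨s(a, b), ⟨hTQ (Or.inl rfl), heM⟩, fun h => heP h.1⟩)⟩

theorem stmt0 {V : Type*} [Fintype V] (G : SimpleGraph V) (n k : ℕ)
    (hn : Fintype.card V = 2 * n) (hk : 2 ≤ k) (hkn : k ≤ n - 1)
    (hG : KExt G k) : KExt G (k - 1) := by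
  obtain ⟨hconn, hpm, hext⟩ := hG
  refine ⟨hconn, hpm, fun M hM hMk => ?_⟩
  by_contra! hno
  have hgrow : ∀ j : ℕ, ∃ P : G.Subgraph, P.IsPerfectMatching ∧
      j ≤ (P.edgeSet ∩ M.edgeSet).ncard := by
    intro j
    induction j with
    | zero => exact hpm.imp fun P hP => ⟨hP, Nat.zero_le _⟩
    | succ j ih =>
      obtain ⟨P, hP, hj⟩ := ih
      obtain ⟨Q, hQ, hlt⟩ := exists_isPerfectMatching_ncard_inter_lt (m := k - 1) (by omega)
        (by rwa [Nat.sub_add_cancel (by omega)]) hM hMk hP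
        fun h => hno P hP (hM.le_of_edgeSet_subset h)
      exact ⟨Q, hQ, hj.trans_lt hlt⟩
  obtain ⟨P, -, hkP⟩ := hgrow k
  have hle := Set.ncard_le_ncard (Set.inter_subset_right : P.edgeSet ∩ M.edgeSet ⊆ M.edgeSet)
  omega
end

section
/- Let G be a finite simple graph of order 2n and let k be an integer with 1 ≤ k ≤ n−1. If G is k-extendable, then G is (k+1)-connected. -/
open SimpleGraph

/-- A graph is `m`-connected if it has at least `m + 1` vertices and deleting any set of
fewer than `m` vertices leaves a connected graph. -/
def MConnected {V : Type*} [Fintype V] (G : SimpleGraph V) (m : ℕ) : Prop :=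
  m + 1 ≤ Fintype.card V ∧ ∀ S : Set V, S.ncard < m → (G.induce Sᶜ).Connected

namespace Extendable

variable {V : Type*} {G : SimpleGraph V}

/-- A matching of `G` with all its vertices in `W`, encoded as the involution that exchanges
matched vertices and fixes unmatched ones. -/
structure IsMatchingOn (G : SimpleGraph V) (W : Finset V) (g : Equiv.Perm V) : Prop where
  invol : ∀ v, g (g v) = v
  mem : ∀ v, g v ≠ v → v ∈ W
  adj : ∀ v, g v ≠ v → G.Adj v (g v)

/-- A perfect matching of the subgraph of `G` induced by `W`, encoded as an involution. -/
structure IsPerfectOn (G : SimpleGraph V) (W : Finset V) (f : Equiv.Perm V) : Prop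
    extends IsMatchingOn G W f where
  ne : ∀ v ∈ W, f v ≠ v

/-- The sets `A` and `B` are nonempty disjoint parts of `W` with no edge between them. -/
structure Separates (G : SimpleGraph V) (W A B : Finset V) : Prop where
  left_subset : A ⊆ W
  right_subset : B ⊆ W
  disjoint : Disjoint A B
  left_nonempty : A.Nonempty
  right_nonempty : B.Nonempty
  not_adj : ∀ a ∈ A, ∀ b ∈ B, ¬ G.Adj a b

/-- Every separation of `W` has order greater than `k`. -/
def SeparationsExceed (G : SimpleGraph V) (W : Finset V) (k : ℕ) : Prop :=
  ∀ A B, Separates G W A B → A.card + B.card + k < W.card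

theorem Separates.symm {W A B : Finset V} (h : Separates G W A B) : Separates G W B A :=
  ⟨h.2, h.1, h.3.symm, h.5, h.4, fun b hb a ha hab => h.6 a ha b hb hab.symm⟩

theorem IsMatchingOn.even_card {W X : Finset V} {f : Equiv.Perm V} (hf : IsMatchingOn G W f)
    (hX : ∀ v ∈ X, f v ∈ X) (hne : ∀ v ∈ X, f v ≠ v) : Even X.card := by
  have h : ∑ _v ∈ X, (1 : ZMod 2) = 0 :=
    Finset.sum_involution (fun v _ => f v) (fun _ _ => by decide) (fun v hv _ => hne v hv)
      (fun v hv => hX v hv) (fun v _ => hf.invol v)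
  rw [Finset.sum_const, nsmul_one] at h
  exact (ZMod.natCast_eq_zero_iff_even).1 h

theorem IsMatchingOn.mono {W W' : Finset V} {g : Equiv.Perm V} (h : IsMatchingOn G W g)
    (hW : W ⊆ W') : IsMatchingOn G W' g := ⟨h.1, fun v hv => hW (h.2 v hv), h.3⟩

/-- The subgraph whose edges join the vertices exchanged by the involution `g`. -/
def IsMatchingOn.toSubgraph {W : Finset V} {g : Equiv.Perm V} (hg : IsMatchingOn G W g) :
    G.Subgraph where
  verts := {v | g v ≠ v}
  Adj v w := g v = w ∧ v ≠ w
  adj_sub := by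
    rintro v w ⟨rfl, h⟩
    exact hg.adj v h.symm
  edge_vert := by
    rintro v w ⟨rfl, h⟩
    exact h.symm
  symm := ⟨by
    rintro v w ⟨rfl, h⟩
    exact ⟨hg.invol v, h.symm⟩⟩

theorem IsMatchingOn.isMatching_toSubgraph {W : Finset V} {g : Equiv.Perm V}
    (hg : IsMatchingOn G W g) : hg.toSubgraph.IsMatching :=
  fun v hv => ⟨g v, ⟨rfl, Ne.symm hv⟩, fun _ hw => hw.1.symm⟩

theorem IsMatchingOn.mul_of_disjoint {W : Finset V} {f g : Equiv.Perm V}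
    (hf : IsMatchingOn G W f) (hg : IsMatchingOn G W g) (h : f.Disjoint g) :
    IsMatchingOn G W (f * g) := by
  have key : ∀ v, ((f * g) v = f v ∧ g v = v) ∨ ((f * g) v = g v ∧ f v = v) := by
    intro v
    rcases h v with h1 | h1
    · right; rw [h.commute.eq]; simp [h1]
    · left; simp [h1]
  refine ⟨fun v => ?_, fun v hv => ?_, fun v hv => ?_⟩
  · have : (f * g) ((f * g) v) = (f * f) ((g * g) v) := by
      rw [← Equiv.Perm.mul_apply, ← Equiv.Perm.mul_apply, mul_assoc, ← mul_assoc g,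
        ← h.commute.eq, mul_assoc, mul_assoc]
    rw [this]
    simp [hf.invol, hg.invol]
  · rcases key v with ⟨h1, -⟩ | ⟨h1, -⟩ <;> rw [h1] at hv
    exacts [hf.mem v hv, hg.mem v hv]
  · rcases key v with ⟨h1, -⟩ | ⟨h1, -⟩ <;> rw [h1] at hv ⊢
    exacts [hf.adj v hv, hg.adj v hv]

section DecEq

variable [DecidableEq V]

theorem isMatchingOn_swap {W : Finset V} {u v : V} (hu : u ∈ W) (hv : v ∈ W) (h : G.Adj u v) :
    IsMatchingOn G W (Equiv.swap u v) := by
  refine ⟨Equiv.swap_apply_self u v, fun w hw => ?_, fun w hw => ?_⟩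
  all_goals
    rw [Equiv.swap_apply_def] at *
    have := h.symm
    grind

theorem SeparationsExceed.exists_adj_left {W A B : Finset V} {k : ℕ}
    (h : SeparationsExceed G W k) (hs : Separates G W A B)
    (hc : W.card ≤ A.card + B.card + (k + 1)) {u : V} (hu : u ∈ W) (hA : u ∉ A) (hB : u ∉ B) :
    ∃ a ∈ A, G.Adj u a := by
  by_contra! hcon
  have := h A (insert u B) ⟨hs.1, Finset.insert_subset hu hs.2,
    by simp [hA, hs.3], hs.4, by simp, by
      intro a ha b hb
      rw [Finset.mem_insert] at hb
      rcases hb with rfl | hb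
      · exact fun h => hcon a ha h.symm
      · exact hs.6 a ha b hb⟩
  rw [Finset.card_insert_of_notMem hB] at this
  omega

theorem IsPerfectOn.even_card_left {W A B X : Finset V} {f : Equiv.Perm V}
    (hf : IsPerfectOn G W f) (hs : Separates G W A B) (hX : X ⊆ A)
    (h : ∀ v ∈ W, v ∉ X → v ∉ B → f v ∉ X) : Even X.card := by
  refine hf.toIsMatchingOn.even_card (fun v hv => ?_) fun v hv => hf.ne v (hs.1 (hX hv))
  by_contra hn
  have hne := hf.ne v (hs.1 (hX hv))
  refine h (f v) (hf.mem _ (by rw [hf.invol]; exact hne.symm)) hn (fun hB => ?_)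
    (by rwa [hf.invol])
  exact hs.6 v (hX hv) _ hB (hf.adj v hne)

end DecEq

theorem exists_isPerfectOn_univ [Fintype V] {P : G.Subgraph} (hP : P.IsPerfectMatching) :
    ∃ f, IsPerfectOn G Finset.univ f ∧ ∀ v, P.Adj v (f v) := by
  choose f hf hu using fun v => (SimpleGraph.Subgraph.isPerfectMatching_iff.1 hP v)
  have hinv : Function.Involutive f := fun v => (hu (f v) v (hf v).symm).symm
  exact ⟨hinv.toPerm, ⟨⟨hinv, fun _ _ => Finset.mem_univ _, fun v _ => (hf v).adj_sub⟩,
    fun v _ => (hf v).adj_sub.ne'⟩, hf⟩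

variable [Fintype V] [DecidableEq V]

/-- Every matching on `W` with at most `k` edges extends to a perfect matching of `W`. -/
def ExtendsUpTo (G : SimpleGraph V) (W : Finset V) (k : ℕ) : Prop :=
  ∀ g, IsMatchingOn G W g → g.support.card ≤ 2 * k →
    ∃ f, IsPerfectOn G W f ∧ ∀ v, g v ≠ v → f v = g v

theorem exists_invariant_superset {W X : Finset V} {f : Equiv.Perm V} (hf : IsMatchingOn G W f)
    (hX : ∀ v ∈ X, f v ∈ X) (hne : X ⊆ f.support) (j : ℕ) (hj : X.card + 2 * j ≤ f.support.card) :
    ∃ Y, X ⊆ Y ∧ Y ⊆ f.support ∧ (∀ v ∈ Y, f v ∈ Y) ∧ Y.card = X.card + 2 * j := by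
  induction j with
  | zero => exact ⟨X, subset_rfl, hne, hX, rfl⟩
  | succ j ih =>
    obtain ⟨Y, hXY, hY, hYf, hc⟩ := ih (by omega)
    obtain ⟨x, hx, hxY⟩ := Finset.exists_mem_notMem_of_card_lt_card
      (show Y.card < f.support.card by omega)
    have hfx : f x ∉ Y := fun h => hxY (by simpa [hf.invol] using hYf _ h)
    have hxx : f x ≠ x := by simpa using hx
    refine ⟨insert x (insert (f x) Y), fun v hv => by simp [hXY hv], ?_, ?_, ?_⟩
    · intro v hv
      simp only [Finset.mem_insert] at hv
      rcases hv with rfl | rfl | hv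
      · exact hx
      · simpa using hxx
      · exact hY hv
    · intro v hv
      simp only [Finset.mem_insert] at hv ⊢
      rcases hv with rfl | rfl | hv
      · simp
      · simp [hf.invol]
      · simp [hYf v hv]
    · rw [Finset.card_insert_of_notMem (by simp [hxx.symm, hxY]),
        Finset.card_insert_of_notMem hfx, hc]
      omega

theorem IsMatchingOn.exists_restrict {W X : Finset V} {f : Equiv.Perm V}
    (hf : IsMatchingOn G W f) (hX : ∀ v ∈ X, f v ∈ X) (hne : X ⊆ f.support) :
    ∃ g, IsMatchingOn G W g ∧ g.support = X ∧ ∀ v ∈ X, g v = f v := by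
  have hinv : Function.Involutive (fun v => if v ∈ X then f v else v) := by
    intro v
    by_cases hv : v ∈ X
    · simp [hv, hX v hv, hf.invol]
    · simp [hv]
  refine ⟨hinv.toPerm, ⟨hinv, fun v hv => ?_, fun v hv => ?_⟩, ?_, fun v hv => ?_⟩
  · by_cases h : v ∈ X
    · exact hf.mem v (by simpa using hne h)
    · simp [h] at hv
  · by_cases h : v ∈ X
    · simpa [h] using hf.adj v (by simpa using hne h)
    · simp [h] at hv
  · ext v
    by_cases h : v ∈ X
    · simpa [h] using hne h
    · simp [h]
  · simp [hv]

theorem extendsUpTo_of_exact {W : Finset V} {k : ℕ} (hW : 2 * k + 2 ≤ W.card)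
    (hP : ∃ f, IsPerfectOn G W f)
    (hE : ∀ g, IsMatchingOn G W g → g.support.card = 2 * k →
      ∃ f, IsPerfectOn G W f ∧ ∀ v, g v ≠ v → f v = g v) : ExtendsUpTo G W k := by
  classical
  intro M hM hMk
  obtain ⟨f, hf, hmax⟩ := Finset.exists_max_image
    (Finset.univ.filter fun f => IsPerfectOn G W f)
    (fun f => (M.support.filter fun v => f v = M v).card) (by simpa [Finset.Nonempty] using hP)
  replace hf : IsPerfectOn G W f := by simpa using hf
  refine ⟨f, hf, ?_⟩
  by_contra! hcon
  obtain ⟨x, hx, hfx⟩ := hcon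
  obtain ⟨hfi, hfm, hfa⟩ := hf.toIsMatchingOn
  obtain ⟨hMi, hMm, hMa⟩ := hM
  have hy : M (M x) ≠ M x := by rw [hMi]; exact hx.symm
  have hxW := hMm x hx
  have hyW := hMm _ hy
  have hfx' := hf.ne x hxW
  have hfy' := hf.ne _ hyW
  set y := M x with hydef
  have hux : f y ≠ x := fun h => hfx (by rw [← h, hfi])
  have huu : f x ≠ f y := fun h => hx (f.injective h).symm
  have hinv : Function.Involutive (fun z => if z = x then y else if z = y then x else
      if z = f x ∨ z = f y then z else f z) := by
    intro z
    have := hfi z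
    have := hfi x
    have := hfi y
    grind
  set f₂ := hinv.toPerm with hf₂
  have hf₂x : f₂ x = y := by simp [hf₂]
  have hf₂y : f₂ y = x := by simp [hf₂, hx]
  have hf₂o : ∀ z, z ≠ x → z ≠ y → z ≠ f x → z ≠ f y → f₂ z = f z := by
    intro z h1 h2 h3 h4
    simp [hf₂, h1, h2, h3, h4]
  have hf₂u : f₂ (f x) = f x := by simp [hf₂, hfx', hfx]
  have hf₂u' : f₂ (f y) = f y := by simp [hf₂, hfy', hux]
  have hm₂ : IsMatchingOn G W f₂ := by
    refine ⟨hinv, fun v hv => ?_, fun v hv => ?_⟩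
    · by_cases h1 : v = x
      · exact h1 ▸ hxW
      by_cases h2 : v = y
      · exact h2 ▸ hyW
      rw [hf₂o v h1 h2 (by rintro rfl; exact hv hf₂u) (by rintro rfl; exact hv hf₂u')] at hv
      exact hfm v hv
    · by_cases h1 : v = x
      · rw [h1, hf₂x]; exact hMa x hx
      by_cases h2 : v = y
      · rw [h2, hf₂y]; exact (hMa x hx).symm
      have := hf₂o v h1 h2 (by rintro rfl; exact hv hf₂u) (by rintro rfl; exact hv hf₂u')
      rw [this] at hv ⊢
      exact hfa v hv
  have hs₂ : W \ {f x, f y} ⊆ f₂.support := by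
    intro v hv
    simp only [Finset.mem_sdiff, Finset.mem_insert, Finset.mem_singleton, not_or] at hv
    rw [Equiv.Perm.mem_support]
    by_cases h1 : v = x
    · rw [h1, hf₂x]; exact hx
    by_cases h2 : v = y
    · rw [h2, hf₂y]; exact hx.symm
    rw [hf₂o v h1 h2 hv.2.1 hv.2.2]
    exact hf.ne v hv.1
  have hc₂ : 2 * k ≤ f₂.support.card := by
    have h1 := Finset.card_le_card hs₂
    have h2 := Finset.le_card_sdiff {f x, f y} W
    have h3 := Finset.card_le_two (a := f x) (b := f y)
    omega
  set X₀ := insert x (insert y (M.support.filter fun v => f v = M v)) with hX₀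
  have hfX : ∀ v, v ∈ X₀ → f₂ v = M v ∧ v ∈ M.support ∧ f₂ v ∈ X₀ := by
    intro v hv
    by_cases h1 : v = x
    · subst h1; exact ⟨hf₂x, by simpa using hx, by simp [hf₂x, hX₀]⟩
    by_cases h2 : v = y
    · rw [h2]; exact ⟨by rw [hf₂y, hydef, hMi], by simpa using hy, by simp [hf₂y, hX₀]⟩
    simp only [hX₀, Finset.mem_insert, h1, h2, false_or, Finset.mem_filter] at hv
    have h3 : v ≠ f x := by
      rintro rfl
      apply hfx
      have := hv.2
      rw [hfi] at this
      have h := hMi (f x)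
      rw [← this] at h
      exact h.symm
    have h4 : v ≠ f y := by
      rintro rfl
      apply hux
      have := hv.2
      rw [hfi] at this
      have h := hMi (f y)
      rw [← this, hydef, hMi] at h
      exact h.symm
    have h5 := hf₂o v h1 h2 h3 h4
    refine ⟨h5.trans hv.2, hv.1, ?_⟩
    simp only [hX₀, Finset.mem_insert, Finset.mem_filter]
    right; right
    rw [h5, hfi]
    refine ⟨?_, by rw [hv.2, hMi]⟩
    have := hv.1
    rw [hv.2]
    simpa using this
  have hXM : X₀ ⊆ M.support := fun v hv => (hfX v hv).2.1
  have hX₂ : X₀ ⊆ f₂.support := by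
    intro v hv
    have := hXM hv
    rw [Equiv.Perm.mem_support] at this ⊢
    rwa [(hfX v hv).1]
  have hev : Even X₀.card :=
    hm₂.even_card (fun v hv => (hfX v hv).2.2) fun v hv => by simpa using hX₂ hv
  have hle := Finset.card_le_card hXM
  obtain ⟨t, ht⟩ := hev
  obtain ⟨Y, hXY, hYs, hYf, hYc⟩ := exists_invariant_superset hm₂
    (fun v hv => (hfX v hv).2.2) hX₂ (k - t) (by omega)
  obtain ⟨h, hh, hhs, hhf⟩ := hm₂.exists_restrict hYf hYs
  obtain ⟨f', hf', hext⟩ := hE h hh (by rw [hhs]; omega)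
  have hlt := hmax f' (by simpa using hf')
  have hsub : X₀ ⊆ M.support.filter fun v => f' v = M v := by
    intro v hv
    rw [Finset.mem_filter]
    refine ⟨hXM hv, ?_⟩
    have hvY := hXY hv
    rw [hext v (by rw [← Equiv.Perm.mem_support, hhs]; exact hvY), hhf v hvY, (hfX v hv).1]
  have hss : (M.support.filter fun v => f v = M v) ⊂ X₀ := by
    refine Finset.ssubset_iff_subset_ne.2 ⟨fun v hv => by
      simp only [hX₀, Finset.mem_insert, hv, or_true], fun he => ?_⟩
    have : x ∈ M.support.filter fun v => f v = M v := by rw [he]; simp [hX₀]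
    exact hfx (Finset.mem_filter.1 this).2
  have := Finset.card_lt_card hss
  have := Finset.card_le_card hsub
  omega

theorem ExtendsUpTo.mono {W : Finset V} {k l : ℕ} (h : ExtendsUpTo G W l) (hkl : k ≤ l) :
    ExtendsUpTo G W k := fun g hg hc => h g hg (by omega)

theorem ExtendsUpTo.sdiff_pair {W : Finset V} {k : ℕ} (h : ExtendsUpTo G W (k + 1)) {u v : V}
    (hu : u ∈ W) (hv : v ∈ W) (huv : G.Adj u v) : ExtendsUpTo G (W \ {u, v}) k := by
  intro g hg hc
  have hgu : g u = u := by
    by_contra hne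
    simpa using hg.mem u hne
  have hgv : g v = v := by
    by_contra hne
    simpa using hg.mem v hne
  have hd : (Equiv.swap u v).Disjoint g := by
    intro w
    by_cases h1 : w = u
    · exact Or.inr (h1 ▸ hgu)
    by_cases h2 : w = v
    · exact Or.inr (h2 ▸ hgv)
    exact Or.inl (Equiv.swap_apply_of_ne_of_ne h1 h2)
  obtain ⟨f, hf, hfg⟩ := h _ ((isMatchingOn_swap hu hv huv).mul_of_disjoint
    (hg.mono Finset.sdiff_subset) hd) (by
      rw [hd.card_support_mul, Equiv.Perm.card_support_swap huv.ne]
      omega)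
  have hfu : f u = v := by
    rw [hfg u (by simp [hgu, huv.ne'])]
    simp [hgu]
  have hfv : f v = u := by
    rw [hfg v (by simp [hgv, huv.ne])]
    simp [hgv]
  obtain ⟨f', hf', hs, hff⟩ := hf.toIsMatchingOn.exists_restrict (X := W \ {u, v})
    (by
      intro w hw
      simp only [Finset.mem_sdiff, Finset.mem_insert, Finset.mem_singleton, not_or] at hw ⊢
      refine ⟨hf.mem _ ?_, ?_, ?_⟩
      · rw [hf.invol]
        exact (hf.ne w hw.1).symm
      · rintro h; rw [← hfv] at h; exact hw.2.2 (f.injective h)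
      · rintro h; rw [← hfu] at h; exact hw.2.1 (f.injective h))
    (fun w hw => by simpa using hf.ne w (Finset.sdiff_subset hw))
  have hmem : ∀ w, f' w ≠ w ↔ w ∈ W \ {u, v} := fun w => by rw [← hs]; simp
  refine ⟨f', ⟨⟨hf'.invol, fun w hw => (hmem w).1 hw, hf'.adj⟩, fun w hw => (hmem w).2 hw⟩,
    fun w hw => ?_⟩
  have hwW := hg.mem w hw
  have hsw : (Equiv.swap u v * g) w = g w := by
    rw [hd.commute.eq, Equiv.Perm.mul_apply, (hd w).resolve_right hw]
  rw [hff w hwW, hfg w (by rwa [hsw]), hsw]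

theorem not_even_card_left {W A B : Finset V} (hs : Separates G W A B)
    (h0 : SeparationsExceed G W 0) (hE : ExtendsUpTo G W 1)
    (hc : W.card = A.card + B.card + 1) : ¬ Even A.card := by
  intro hev
  obtain ⟨s, hsW, hsn⟩ := Finset.exists_mem_notMem_of_card_lt_card
    (show (A ∪ B).card < W.card by rw [Finset.card_union_of_disjoint hs.3]; omega)
  simp only [Finset.mem_union, not_or] at hsn
  have hW : W = insert s (A ∪ B) := by
    symm
    apply Finset.eq_of_subset_of_card_le
    · exact Finset.insert_subset hsW (Finset.union_subset hs.1 hs.2)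
    · rw [Finset.card_insert_of_notMem (by simpa using hsn), Finset.card_union_of_disjoint hs.3]
      omega
  obtain ⟨a, ha, hsa⟩ := h0.exists_adj_left hs hc.le hsW hsn.1 hsn.2
  obtain ⟨f, hf, hfg⟩ := hE _ (isMatchingOn_swap hsW (hs.1 ha) hsa)
    (by rw [Equiv.Perm.card_support_swap hsa.ne])
  have hfs : f s = a := by rw [hfg s (by simp [hsa.ne'])]; simp
  have hfa : f a = s := by rw [hfg a (by simp [hsa.ne])]; simp
  have := hf.even_card_left hs (X := A.erase a) (Finset.erase_subset _ _) (by
    intro v hv hvX hvB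
    simp only [hW, Finset.mem_insert, Finset.mem_union, hvB, or_false] at hv
    grind)
  rw [Finset.card_erase_of_mem ha] at this
  have := Finset.card_pos.2 hs.4
  grind

theorem not_adj_of_separates {W A B : Finset V} {u v : V} (hs : Separates G W A B)
    (h1 : SeparationsExceed G W 1) (hE : ExtendsUpTo G W 2) (huW : u ∈ W) (hvW : v ∈ W)
    (hu : u ∉ A ∪ B) (hv : v ∉ A ∪ B) (hc : W.card ≤ A.card + B.card + 2) : ¬ G.Adj u v := by
  intro huv
  have hW : W = insert u (insert v (A ∪ B)) := by
    symm
    apply Finset.eq_of_subset_of_card_le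
    · exact Finset.insert_subset huW (Finset.insert_subset hvW (Finset.union_subset hs.1 hs.2))
    · rw [Finset.card_insert_of_notMem (by rw [Finset.mem_insert]; exact not_or.2 ⟨huv.ne, hu⟩),
        Finset.card_insert_of_notMem hv, Finset.card_union_of_disjoint hs.3]
      omega
  simp only [Finset.mem_union, not_or] at hu hv
  obtain ⟨a, ha, hua⟩ := h1.exists_adj_left hs hc huW hu.1 hu.2
  obtain ⟨b, hb, hvb⟩ := h1.exists_adj_left hs.symm (by omega) hvW hv.2 hv.1
  obtain ⟨f, hf, hfg⟩ := hE _ (isMatchingOn_swap huW hvW huv)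
    (by rw [Equiv.Perm.card_support_swap huv.ne]; omega)
  have hfu : f u = v := by rw [hfg u (by simp [huv.ne'])]; simp
  have hfv : f v = u := by rw [hfg v (by simp [huv.ne])]; simp
  have hA := hf.even_card_left hs (X := A) subset_rfl (by
    intro w hw hwX hwB
    simp only [hW, Finset.mem_insert, Finset.mem_union, hwB, or_false] at hw
    grind)
  have hab : a ≠ b := fun h => Finset.disjoint_left.1 hs.3 ha (h ▸ hb)
  have hd : (Equiv.swap u a).Disjoint (Equiv.swap v b) := by
    intro w
    have := huv.ne
    simp only [Equiv.swap_apply_def]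
    grind
  obtain ⟨f', hf', hfg'⟩ := hE _ ((isMatchingOn_swap huW (hs.1 ha) hua).mul_of_disjoint
    (isMatchingOn_swap hvW (hs.2 hb) hvb) hd) (by
      rw [hd.card_support_mul, Equiv.Perm.card_support_swap hua.ne,
        Equiv.Perm.card_support_swap hvb.ne])
  have hne := huv.ne
  have hub : u ≠ b := by rintro rfl; exact hu.2 hb
  have hva : v ≠ a := by rintro rfl; exact hv.1 ha
  have e1 : (Equiv.swap u a * Equiv.swap v b) u = a := by
    simp [Equiv.swap_apply_of_ne_of_ne hne hub]
  have e2 : (Equiv.swap u a * Equiv.swap v b) v = b := by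
    simp [Equiv.swap_apply_of_ne_of_ne hub.symm hab.symm]
  have hfu' : f' u = a := by rw [hfg' u (by rw [e1]; exact hua.ne'), e1]
  have hfv' : f' v = b := by rw [hfg' v (by rw [e2]; exact hvb.ne'), e2]
  have hfa' : f' a = u := by rw [← hfu', hf'.invol]
  have hA' := hf'.even_card_left hs (X := A.erase a) (Finset.erase_subset _ _) (by
    intro w hw hwX hwB
    simp only [hW, Finset.mem_insert, Finset.mem_union, hwB, or_false] at hw
    have := Finset.disjoint_left.1 hs.3
    grind)
  rw [Finset.card_erase_of_mem ha] at hA'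
  have := Finset.card_pos.2 hs.4
  grind

theorem separationsExceed_of_extendsUpTo (k : ℕ) : ∀ W : Finset V, 2 * k + 2 ≤ W.card →
    ExtendsUpTo G W k → SeparationsExceed G W 0 → SeparationsExceed G W k := by
  induction k with
  | zero => exact fun _ _ _ h => h
  | succ k ih =>
    intro W hW hE h0
    have hk := ih W (by omega) (hE.mono (by omega)) h0
    have aux : ∀ A B, Separates G W A B → W.card = A.card + B.card + (k + 1) → 0 < k →
        ¬ 2 ≤ A.card := by
      intro A B hs hc hk0 hA2
      obtain ⟨u, huW, hun⟩ := Finset.exists_mem_notMem_of_card_lt_card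
        (show (A ∪ B).card < W.card by rw [Finset.card_union_of_disjoint hs.3]; omega)
      simp only [Finset.mem_union, not_or] at hun
      obtain ⟨v, hv, huv⟩ := hk.exists_adj_left hs hc.le huW hun.1 hun.2
      have hvW := hs.1 hv
      have hvB := Finset.disjoint_left.1 hs.3 hv
      have hW' : (W \ {u, v}).card + 2 = W.card := by
        rw [← Finset.card_pair huv.ne]
        exact Finset.card_sdiff_add_card_eq_card
          (Finset.insert_subset huW (Finset.singleton_subset_iff.2 hvW))
      have hA' := Finset.card_erase_of_mem hv
      by_cases hcon : SeparationsExceed G (W \ {u, v}) 0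
      · have := ih _ (by omega) (hE.sdiff_pair huW hvW huv) hcon (A.erase v) B
          ⟨fun w hw => by have := @hs.1 w; grind, fun w hw => by have := @hs.2 w; grind,
            hs.3.mono_left (Finset.erase_subset _ _),
            by rw [← Finset.card_pos]; omega, hs.5,
            fun a ha b hb => hs.6 a (Finset.mem_of_mem_erase ha) b hb⟩
        omega
      · simp only [SeparationsExceed, not_forall, not_lt] at hcon
        obtain ⟨A', B', hs', hc'⟩ := hcon
        have hsW : Separates G W A' B' :=
          ⟨hs'.1.trans Finset.sdiff_subset, hs'.2.trans Finset.sdiff_subset, hs'.3, hs'.4,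
            hs'.5, hs'.6⟩
        have := hk A' B' hsW
        obtain rfl : k = 1 := by omega
        have hsub := Finset.union_subset hs'.1 hs'.2
        exact not_adj_of_separates hsW hk hE huW hvW (fun h => by simpa using hsub h)
          (fun h => by simpa using hsub h) (by omega) huv
    intro A B hs
    by_contra hlt
    have hlt' := hk A B hs
    rcases Nat.eq_zero_or_pos k with rfl | hpos
    · have hA := not_even_card_left hs h0 hE (by omega)
      have hB := not_even_card_left hs.symm h0 hE (by omega)
      obtain ⟨f, hf, -⟩ := hE 1 ⟨fun _ => rfl, fun v hv => absurd rfl hv,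
        fun v hv => absurd rfl hv⟩ (by simp)
      have := hf.toIsMatchingOn.even_card (X := W)
        (fun v hv => hf.mem _ (by rw [hf.invol]; exact (hf.ne v hv).symm)) hf.ne
      grind
    · have := aux A B hs (by omega) hpos
      have := aux B A hs.symm (by omega) hpos
      omega

theorem separationsExceed_zero_of_connected (hG : G.Connected) :
    SeparationsExceed G Finset.univ 0 := by
  intro A B hs
  by_contra hlt
  have hU : A ∪ B = Finset.univ := by
    rw [← Finset.card_eq_iff_eq_univ, Finset.card_union_of_disjoint hs.3]
    have := Finset.card_le_univ (A ∪ B)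
    rw [Finset.card_union_of_disjoint hs.3] at this
    rw [Finset.card_univ] at hlt
    omega
  obtain ⟨a, ha⟩ := hs.4
  obtain ⟨b, hb⟩ := hs.5
  obtain ⟨p⟩ := hG.preconnected a b
  obtain ⟨d, -, hd1, hd2⟩ := p.exists_boundary_dart (A : Set V) (by simpa using ha)
    (by simpa using Finset.disjoint_right.1 hs.3 hb)
  have : d.snd ∈ A ∪ B := by simp [hU]
  rw [Finset.mem_union] at this
  exact hs.6 d.fst (by simpa using hd1) d.snd (this.resolve_left (by simpa using hd2)) d.adj

theorem induce_compl_connected {k : ℕ} (h : SeparationsExceed G Finset.univ k)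
    (hk : k < Fintype.card V) (S : Set V) (hS : S.ncard ≤ k) : (G.induce Sᶜ).Connected := by
  classical
  have hne : ∃ x, x ∉ S := by
    by_contra! hall
    rw [Set.eq_univ_of_forall hall, Set.ncard_univ, Nat.card_eq_fintype_card] at hS
    omega
  obtain ⟨x₀, hx₀⟩ := hne
  have : Nonempty ↑Sᶜ := ⟨⟨x₀, hx₀⟩⟩
  refine ⟨fun x y => ?_⟩
  by_contra hxy
  let A : Finset V := Finset.univ.filter fun v => ∃ hv : v ∈ Sᶜ, (G.induce Sᶜ).Reachable x ⟨v, hv⟩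
  let B : Finset V := Finset.univ.filter fun v => v ∉ S ∧ v ∉ A
  have hd : Disjoint A B := Finset.disjoint_left.2 fun v hv hv' => by
    simp only [B, Finset.mem_filter] at hv'
    exact hv'.2.2 hv
  have := h A B ⟨Finset.subset_univ _, Finset.subset_univ _, hd, ⟨x, by
      simp only [A, Finset.mem_filter, Finset.mem_univ, true_and]
      exact ⟨x.2, SimpleGraph.Reachable.refl _⟩⟩,
    ⟨y, by
      simp only [B, A, Finset.mem_filter, Finset.mem_univ, true_and]
      exact ⟨y.2, fun ⟨_, hr⟩ => hxy hr⟩⟩, by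
      intro a ha b hb hab
      simp only [A, Finset.mem_filter, Finset.mem_univ, true_and] at ha
      simp only [B, A, Finset.mem_filter, Finset.mem_univ, true_and] at hb
      obtain ⟨haS, har⟩ := ha
      refine hb.2 ⟨hb.1, har.trans (SimpleGraph.Adj.reachable ?_)⟩
      simpa using hab⟩
  have hU : Finset.univ ⊆ (A ∪ B) ∪ S.toFinset := by
    intro v _
    simp only [Finset.mem_union, Set.mem_toFinset]
    by_cases hvS : v ∈ S
    · exact Or.inr hvS
    by_cases hvA : v ∈ A
    · exact Or.inl (Or.inl hvA)
    · exact Or.inl (Or.inr (by simp [B, hvS, hvA]))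
  have h1 := Finset.card_le_card hU
  have h2 := Finset.card_union_le (A ∪ B) S.toFinset
  rw [Finset.card_union_of_disjoint hd] at h2
  rw [Set.ncard_eq_toFinset_card'] at hS
  omega

theorem IsMatchingOn.two_mul_ncard_edgeSet_toSubgraph {W : Finset V} {g : Equiv.Perm V}
    (hg : IsMatchingOn G W g) : 2 * hg.toSubgraph.edgeSet.ncard = g.support.card := by
  classical
  have hs := hg.toSubgraph.spanningCoe.sum_degrees_eq_twice_card_edges
  have he : hg.toSubgraph.edgeSet.ncard = hg.toSubgraph.spanningCoe.edgeFinset.card := by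
    rw [Set.ncard_eq_toFinset_card']
    congr 1
    ext e
    simp
  rw [he, ← hs, Finset.card_eq_sum_ones, ← Finset.sum_subset (Finset.subset_univ g.support)]
  · refine Finset.sum_congr rfl fun v hv => ?_
    rw [← SimpleGraph.card_neighborFinset_eq_degree, Finset.card_eq_one]
    refine ⟨g v, ?_⟩
    ext w
    simp only [SimpleGraph.mem_neighborFinset, Finset.mem_singleton]
    rw [Equiv.Perm.mem_support] at hv
    exact ⟨fun h => h.1.symm, fun h => ⟨h.symm, h ▸ hv.symm⟩⟩
  · intro v _ hv
    rw [← SimpleGraph.card_neighborFinset_eq_degree, Finset.card_eq_zero]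
    ext w
    simp only [SimpleGraph.mem_neighborFinset, Finset.notMem_empty, iff_false]
    rw [Equiv.Perm.notMem_support] at hv
    exact fun h => h.2 (hv ▸ h.1)

theorem _root_.KExt.extendsUpTo {k : ℕ} (h : KExt G k) (hk : 2 * k + 2 ≤ Fintype.card V) :
    ExtendsUpTo G Finset.univ k := by
  obtain ⟨-, ⟨P, hP⟩, hM⟩ := h
  refine extendsUpTo_of_exact (by simpa using hk)
    ((exists_isPerfectOn_univ hP).imp fun _ h => h.1) fun g hg hc => ?_
  obtain ⟨Q, hQ, hle⟩ := hM hg.toSubgraph hg.isMatching_toSubgraph (by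
    have := hg.two_mul_ncard_edgeSet_toSubgraph
    omega)
  obtain ⟨f, hf, hfQ⟩ := exists_isPerfectOn_univ hQ
  exact ⟨f, hf, fun v hv => hQ.1.eq_of_adj_left (hfQ v) (hle.2 ⟨rfl, hv.symm⟩)⟩

end Extendable

theorem stmt1 {V : Type*} [Fintype V] (G : SimpleGraph V) (n k : ℕ)
    (hn : Fintype.card V = 2 * n) (hk : 1 ≤ k) (hkn : k ≤ n - 1)
    (hG : KExt G k) : MConnected G (k + 1) := by
  classical
  refine ⟨by omega, fun S hS => ?_⟩
  exact Extendable.induce_compl_connected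
    (Extendable.separationsExceed_of_extendsUpTo k Finset.univ (by rw [Finset.card_univ]; omega)
      (hG.extendsUpTo (by omega)) (Extendable.separationsExceed_zero_of_connected hG.1))
    (by omega) S (by omega)
end

section
/- Let G be a finite simple graph that is 2-extendable. Then every tight cut of G is trivial; that is, if X ⊆ V(G) with |X| odd and |V(G)∖X| odd is such that every perfect matching of G contains exactly one edge of the edge cut ∂(X), then |X| = 1 or |V(G)∖X| = 1. (Equivalently, G is a brick or a brace.) -/
open SimpleGraph

/-- The edge `e` lies in the edge cut `∂(X)`: it has exactly one end-vertex in `X`. -/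
def CrossesCut {V : Type*} (X : Set V) (e : Sym2 V) : Prop :=
  ∃ x y : V, e = s(x, y) ∧ x ∈ X ∧ y ∉ X

/-- In a 2-extendable graph, two disjoint edges lie in a common perfect matching. -/
theorem KExt.exists_isPerfectMatching_adj_adj {V : Type*} [Fintype V] {G : SimpleGraph V}
    (h : KExt G 2) {a b c d : V} (hab : G.Adj a b) (hcd : G.Adj c d)
    (hac : a ≠ c) (had : a ≠ d) (hbc : b ≠ c) (hbd : b ≠ d) :
    ∃ P : G.Subgraph, P.IsPerfectMatching ∧ P.Adj a b ∧ P.Adj c d := by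
  obtain ⟨P, hP, hle⟩ := h.2.2 (G.subgraphOfAdj hab ⊔ G.subgraphOfAdj hcd)
    ((Subgraph.IsMatching.subgraphOfAdj hab).sup (Subgraph.IsMatching.subgraphOfAdj hcd) (by
      rw [support_subgraphOfAdj, support_subgraphOfAdj, Set.disjoint_left]
      rintro x (rfl | rfl) (rfl | rfl) <;> contradiction))
    (by
      rw [Subgraph.edgeSet_sup, edgeSet_subgraphOfAdj, edgeSet_subgraphOfAdj,
        Set.singleton_union, Set.ncard_pair]
      intro heq
      rcases Sym2.eq_iff.mp heq with ⟨h, -⟩ | ⟨h, -⟩ <;> contradiction)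
  exact ⟨P, hP, hle.2 (by simp), hle.2 (by simp)⟩

/-- In a connected graph, if every edge leaving `X` leaves from `v` and `X` contains
a vertex other than `v`, then `v` has a neighbour in `X`. -/
theorem SimpleGraph.Connected.exists_adj_mem_of_forall_boundary_eq {V : Type*}
    {G : SimpleGraph V} (hG : G.Connected) {X : Set V} {u v : V} (hu : u ∈ X)
    (huv : u ≠ v) (hcut : ∀ a b, a ∈ X → b ∉ X → G.Adj a b → a = v) :
    ∃ w ∈ X, G.Adj v w := by
  obtain ⟨p⟩ := hG u v
  obtain ⟨d, -, hd, hd'⟩ := p.exists_boundary_dart (X \ {v}) ⟨hu, huv⟩ (fun h ↦ h.2 rfl)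
  by_cases hdX : d.snd ∈ X
  · have hdv : d.snd = v := by_contra fun hne ↦ hd' ⟨hdX, hne⟩
    exact ⟨d.fst, hd.1, hdv ▸ d.adj.symm⟩
  · exact absurd (hcut _ _ hd.1 hdX d.adj) hd.2

/-- In a graph with more than four vertices and a perfect matching, any two vertices are avoided
by some edge. -/
theorem SimpleGraph.Subgraph.IsPerfectMatching.exists_adj_ne {V : Type*} [Fintype V]
    {G : SimpleGraph V} {P : G.Subgraph} (hP : P.IsPerfectMatching)
    (hcard : 4 < Fintype.card V) (v w : V) :
    ∃ y z, P.Adj y z ∧ v ≠ y ∧ v ≠ z ∧ w ≠ y ∧ w ≠ z := by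
  classical
  have hP' := Subgraph.isPerfectMatching_iff.mp hP
  obtain ⟨v', hv', hv'u⟩ := hP' v
  obtain ⟨w', hw', hw'u⟩ := hP' w
  obtain ⟨y, hy⟩ : ∃ y, y ∉ ({v, w, v', w'} : Finset V) := by
    by_contra! hall
    have := Finset.card_le_card (fun x _ ↦ hall x : Finset.univ ⊆ ({v, w, v', w'} : Finset V))
    rw [Finset.card_univ] at this
    exact absurd (this.trans Finset.card_le_four) (by lia)
  obtain ⟨z, hz, -⟩ := hP' y
  simp only [Finset.mem_insert, Finset.mem_singleton, not_or] at hy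
  refine ⟨y, z, hz, Ne.symm hy.1, ?_, Ne.symm hy.2.1, ?_⟩
  · rintro rfl
    exact hy.2.2.1 (hv'u y hz.symm)
  · rintro rfl
    exact hy.2.2.2 (hw'u y hz.symm)

/-- If every perfect matching of a 2-extendable graph on more than four vertices meets the cut
`∂(X)` and all edges of the cut share a vertex `v ∈ X`, then `X = {v}`. -/
theorem KExt.eq_singleton_of_forall_boundary_eq {V : Type*} [Fintype V] {G : SimpleGraph V}
    (h : KExt G 2) (hcard : 4 < Fintype.card V) {X : Set V} {v : V} (hv : v ∈ X)
    (hcut : ∀ a b, a ∈ X → b ∉ X → G.Adj a b → a = v)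
    (hmeet : ∀ P : G.Subgraph, P.IsPerfectMatching → ∃ a b, a ∈ X ∧ b ∉ X ∧ P.Adj a b) :
    X = {v} := by
  by_contra hX
  obtain ⟨u, hu, huv⟩ : ∃ u ∈ X, u ≠ v := by
    by_contra! hall
    exact hX (Set.eq_singleton_iff_unique_mem.mpr ⟨hv, hall⟩)
  obtain ⟨w, hw, hvw⟩ := h.1.exists_adj_mem_of_forall_boundary_eq hu huv hcut
  obtain ⟨P₀, hP₀⟩ := h.2.1
  obtain ⟨y, z, hyz, hvy, hvz, hwy, hwz⟩ := hP₀.exists_adj_ne hcard v w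
  obtain ⟨P, hP, hPvw, -⟩ :=
    h.exists_isPerfectMatching_adj_adj hvw hyz.adj_sub hvy hvz hwy hwz
  obtain ⟨a, b, ha, hb, hab⟩ := hmeet P hP
  obtain rfl := hcut a b ha hb hab.adj_sub
  exact hb (hP.1.eq_of_adj_left hPvw hab ▸ hw)

theorem stmt2 {V : Type*} [Fintype V] (G : SimpleGraph V) (h2 : KExt G 2)
    (X : Set V) (hXodd : Odd X.ncard) (hXcodd : Odd (Xᶜ).ncard)
    (htight : ∀ P : G.Subgraph, P.IsPerfectMatching →
      Set.ncard {e ∈ P.edgeSet | CrossesCut X e} = 1) :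
    X.ncard = 1 ∨ (Xᶜ).ncard = 1 := by
  have hunique : ∀ P : G.Subgraph, P.IsPerfectMatching → ∀ a b c d, a ∈ X → b ∉ X → c ∈ X →
      d ∉ X → P.Adj a b → P.Adj c d → a = c := by
    intro P hP a b c d ha hb hc hd hab hcd
    obtain ⟨e, he⟩ := Set.ncard_eq_one.mp (htight P hP)
    have hab' : s(a, b) ∈ ({e} : Set (Sym2 V)) := he ▸ ⟨hab, a, b, rfl, ha, hb⟩
    have hcd' : s(c, d) ∈ ({e} : Set (Sym2 V)) := he ▸ ⟨hcd, c, d, rfl, hc, hd⟩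
    rcases Sym2.eq_iff.mp (hab'.trans hcd'.symm) with ⟨h, -⟩ | ⟨h, -⟩
    · exact h
    · exact absurd (h ▸ ha) hd
  have hmeet : ∀ P : G.Subgraph, P.IsPerfectMatching → ∃ a b, a ∈ X ∧ b ∉ X ∧ P.Adj a b := by
    intro P hP
    obtain ⟨e, he⟩ := Set.ncard_eq_one.mp (htight P hP)
    have hmem : e ∈ {e ∈ P.edgeSet | CrossesCut X e} := he ▸ rfl
    obtain ⟨hPe, a, b, rfl, ha, hb⟩ := hmem
    exact ⟨a, b, ha, hb, hPe⟩
  have hshare : ∀ a b c d, a ∈ X → b ∉ X → c ∈ X → d ∉ X → G.Adj a b → G.Adj c d →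
      a = c ∨ b = d := by
    intro a b c d ha hb hc hd hab hcd
    by_contra! hne
    obtain ⟨P, hP, hPab, hPcd⟩ := h2.exists_isPerfectMatching_adj_adj hab hcd hne.1
      (fun h ↦ hd (h ▸ ha)) (fun h ↦ hb (h ▸ hc)) hne.2
    exact hne.1 (hunique P hP a b c d ha hb hc hd hPab hPcd)
  by_contra! hnontriv
  have hcard : 4 < Fintype.card V := by
    have := Set.ncard_add_ncard_compl X
    rw [Nat.card_eq_fintype_card] at this
    obtain ⟨m, hm⟩ := hXodd
    obtain ⟨n, hn⟩ := hXcodd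
    lia
  obtain ⟨P₀, hP₀⟩ := h2.2.1
  obtain ⟨x, y, hx, hy, hP₀xy⟩ := hmeet P₀ hP₀
  have hxy := hP₀xy.adj_sub
  by_cases hstar : ∀ a b, a ∈ X → b ∉ X → G.Adj a b → a = x
  · exact hnontriv.1 (h2.eq_singleton_of_forall_boundary_eq hcard hx hstar hmeet ▸
      Set.ncard_singleton x)
  · push Not at hstar
    obtain ⟨a, b, ha, hb, hab, hax⟩ := hstar
    obtain rfl := (hshare a b x y ha hb hx hy hab hxy).resolve_left hax
    refine hnontriv.2 (h2.eq_singleton_of_forall_boundary_eq (X := Xᶜ) hcard hy ?_ ?_ ▸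
      Set.ncard_singleton b)
    · intro d c hd hc hdc
      have hc' := Set.notMem_compl_iff.mp hc
      by_contra hdb
      have hca := (hshare c d a b hc' hd ha hb hdc.symm hab).resolve_right hdb
      have hcx := (hshare c d x b hc' hd hx hy hdc.symm hxy).resolve_right hdb
      exact hax (hca.symm.trans hcx)
    · intro P hP
      obtain ⟨c, d, hc, hd, hcd⟩ := hmeet P hP
      exact ⟨d, c, hd, Set.notMem_compl_iff.mpr hc, hcd.symm⟩
end

section
/- Let G be a finite simple graph of order 2n that is a minimal k-extendable graph for an integer k with 1 ≤ k ≤ n−1, and suppose G is not the complete graph K_{2n}. Then the minimum degree of G satisfies δ(G) ≤ n + k − 1. -/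
open SimpleGraph

/-- A `k`-extendable graph is minimal if deleting any edge destroys `k`-extendability. -/
def MinimalKExt {V : Type*} [Fintype V] (G : SimpleGraph V) (k : ℕ) : Prop :=
  KExt G k ∧ ∀ e ∈ G.edgeSet, ¬ KExt (G.deleteEdges {e}) k

/-- A matching of `G`, encoded as the involution that swaps the ends of each matching edge and
fixes the unmatched vertices. -/
structure PartialMatching {V : Type*} (G : SimpleGraph V) (f : V → V) : Prop where
  invol : ∀ v, f (f v) = v
  adj : ∀ v, f v ≠ v → G.Adj v (f v)

namespace PartialMatching
variable {V : Type*} {G : SimpleGraph V} {f : V → V}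

open Classical in
theorem exists_pair (hf : PartialMatching G f) {x a : V} (hx : f x = x) (ha : f a = a)
    (hxa : G.Adj x a) :
    ∃ g, PartialMatching G g ∧ {v | g v = v} ⊂ {v | f v = v} := by
  have hi := hf.invol
  have hA := hf.adj
  have hne := hxa.ne
  have hs := hxa.symm
  refine ⟨fun v => if v = x then a else if v = a then x else f v, ⟨?_, ?_⟩, ?_⟩
  · grind
  · grind
  · refine ⟨?_, fun h => ?_⟩
    · intro v; simp only [Set.mem_ofPred_eq]; grind
    · have := h (show x ∈ {v | f v = v} from hx)
      simp only [Set.mem_ofPred_eq] at this; grind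

open Classical in
theorem exists_augment (hf : PartialMatching G f) {x y a : V} (hxy : x ≠ y) (hx : f x = x)
    (hy : f y = y) (ha : f a ≠ a) (hxa : G.Adj x a) (hya : G.Adj y (f a)) :
    ∃ g, PartialMatching G g ∧ {v | g v = v} ⊂ {v | f v = v} := by
  have hi := hf.invol
  have hA := hf.adj
  have h1 := hxa.ne
  have h2 := hxa.symm
  have h3 := hya.ne
  have h4 := hya.symm
  refine ⟨fun v => if v = x then a else if v = a then x else if v = y then f a
    else if v = f a then y else f v, ⟨?_, ?_⟩, ?_⟩
  · grind
  · grind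
  · refine ⟨?_, fun h => ?_⟩
    · intro v; simp only [Set.mem_ofPred_eq]; grind
    · have := h (show x ∈ {v | f v = v} from hx)
      simp only [Set.mem_ofPred_eq] at this; grind

open Classical in
theorem exists_rotate (hf : PartialMatching G f) {x a : V} (hx : f x = x) (ha : f a ≠ a)
    (hxa : G.Adj x a) :
    ∃ g, PartialMatching G g ∧ {v | g v = v} = insert (f a) ({v | f v = v} \ {x}) := by
  have hi := hf.invol
  have hA := hf.adj
  have h1 := hxa.ne
  have h2 := hxa.symm
  refine ⟨fun v => if v = x then a else if v = a then x else if v = f a then v else f v,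
    ⟨?_, ?_⟩, ?_⟩
  · grind
  · grind
  · ext v; simp only [Set.mem_ofPred_eq, Set.mem_insert_iff, Set.mem_sdiff, Set.mem_singleton_iff]
    grind

theorem degree_add_degree_le [Fintype V] [∀ v, Fintype (G.neighborSet v)]
    (hf : PartialMatching G f)
    (hmax : ∀ g, PartialMatching G g → ¬ {v | g v = v} ⊂ {v | f v = v})
    {x y : V} (hxy : x ≠ y) (hx : f x = x) (hy : f y = y) :
    G.degree x + G.degree y + 2 ≤ Fintype.card V := by
  classical
  set w : V → ℕ := fun a => (if G.Adj x a then 1 else 0) + (if G.Adj y a then 1 else 0) with hw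
  have hdeg : ∑ a, w a = G.degree x + G.degree y := by
    simp only [hw, Finset.sum_add_distrib, Finset.sum_boole, Nat.cast_id,
      ← card_neighborFinset_eq_degree]
    congr 2 <;> ext <;> simp
  have hinv : ∑ a, w (f a) = ∑ a, w a :=
    Equiv.sum_comp (Function.Involutive.toPerm f hf.invol) w
  have hfix : ∀ z a, f z = z → f a = a → ¬ G.Adj z a := fun z a hz ha h => by
    obtain ⟨g, hg, hlt⟩ := hf.exists_pair hz ha h
    exact hmax g hg hlt
  have haug : ∀ z t a, z ≠ t → f z = z → f t = t → f a ≠ a → G.Adj z a → ¬ G.Adj t (f a) :=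
    fun z t a hzt hz ht ha h h' => by
      obtain ⟨g, hg, hlt⟩ := hf.exists_augment hzt hz ht ha h h'
      exact hmax g hg hlt
  have hb : ∀ a, w a + w (f a) + (if a ∈ ({x, y} : Finset V) then 2 else 0) ≤ 2 := by
    intro a
    by_cases ha : f a = a
    · have h1 := hfix x a hx ha
      have h2 := hfix y a hy ha
      simp only [hw, ha, h1, h2, if_false]
      split_ifs <;> simp
    · have h1 := haug x y a hxy hx hy ha
      have h2 := haug y x a hxy.symm hy hx ha
      have h3 : a ∉ ({x, y} : Finset V) := by
        simp only [Finset.mem_insert, Finset.mem_singleton]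
        grind
      simp only [hw, h3]
      grind
  have hsum := Finset.sum_le_sum fun a (_ : a ∈ Finset.univ) => hb a
  rw [Finset.sum_add_distrib, Finset.sum_add_distrib, hinv, hdeg] at hsum
  simp only [Finset.sum_ite_mem, Finset.univ_inter, Finset.sum_const, Finset.card_pair hxy,
    smul_eq_mul, Finset.card_univ] at hsum
  omega

end PartialMatching

/-- A graph on `2 * m ≥ 4` vertices with minimum degree at least `m - 1`, attained by at most two
vertices, has a perfect matching. -/
theorem exists_involution_adj {V : Type*} [Fintype V] (G : SimpleGraph V)
    [∀ v, Fintype (G.neighborSet v)] (m : ℕ)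
    (hm : 2 ≤ m) (hcard : Fintype.card V = 2 * m) (hdeg : ∀ v, m ≤ G.degree v + 1)
    (hdef : ∀ x y z, x ≠ y → y ≠ z → x ≠ z →
      m ≤ G.degree x ∨ m ≤ G.degree y ∨ m ≤ G.degree z) :
    ∃ f : V → V, Function.Involutive f ∧ ∀ v, G.Adj v (f v) := by
  classical
  obtain ⟨f, hf, hmin⟩ := Set.exists_min_image {f : V → V | PartialMatching G f}
    (fun f => {v | f v = v}.ncard) (Set.toFinite _) ⟨id, fun _ => rfl, fun _ h => (h rfl).elim⟩
  have hmax : ∀ g, PartialMatching G g → {v | g v = v}.ncard ≤ {v | f v = v}.ncard →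
      ∀ h, PartialMatching G h → ¬ {v | h v = v} ⊂ {v | g v = v} := fun g _ hgf h hh hlt =>
    (Set.ncard_lt_ncard hlt).not_ge (hgf.trans (hmin h hh))
  refine ⟨f, hf.invol, fun v => hf.adj v fun hv => ?_⟩
  obtain ⟨y, hy, hvy⟩ : ∃ y, f y = y ∧ v ≠ y := by
    by_contra! hcon
    have hpar := Equiv.Perm.card_fixedPoints_modEq (p := 2) (n := 1)
      (α := V) (f := f) (funext hf.invol)
    have hone : Fintype.card (Function.fixedPoints f) = 1 := by
      rw [Fintype.card_eq_one_iff]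
      exact ⟨⟨v, hv⟩, fun z => Subtype.ext (hcon z z.2).symm⟩
    rw [hone, hcard, Nat.ModEq] at hpar
    omega
  have hle := hf.degree_add_degree_le (hmax f hf le_rfl) hvy hv hy
  have hv' := hdeg v
  have hy' := hdeg y
  obtain ⟨a, ha⟩ : ∃ a, G.Adj v a := (G.degree_pos_iff_exists_adj v).1 (by omega)
  have hfa : f a ≠ a := fun h => by
    obtain ⟨g, hg, hlt⟩ := hf.exists_pair hv h ha
    exact hmax f hf le_rfl g hg hlt
  obtain ⟨g, hg, hfix⟩ := hf.exists_rotate hv hfa ha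
  have hffa := hf.invol a
  have hle' := hg.degree_add_degree_le (x := f a) (y := y)
    (hmax g hg (by
      rw [hfix]
      refine (Set.ncard_insert_le _ _).trans_eq ?_
      exact Set.ncard_sdiff_singleton_add_one hv (Set.toFinite _)))
    (by grind) (by have : f a ∈ {v | g v = v} := by rw [hfix]; simp
                   exact this)
    (by have : y ∈ {v | g v = v} := by rw [hfix]; simp [hy, hvy.symm]
        exact this)
  have hfa' := hdeg (f a)
  rcases hdef v y (f a) hvy (by grind) (by grind) with h | h | h <;> omega

theorem SimpleGraph.Subgraph.ncard_verts_le_of_isMatching {V : Type*} [Fintype V]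
    {G : SimpleGraph V} {M : G.Subgraph} (hM : M.IsMatching) :
    M.verts.ncard ≤ 2 * M.edgeSet.ncard := by
  classical
  rw [Set.ncard_eq_toFinset_card', Set.ncard_eq_toFinset_card', mul_comm]
  refine le_trans (Finset.card_le_card fun v hv => ?_)
    (Finset.card_biUnion_le_card_mul M.edgeSet.toFinset Sym2.toFinset 2 fun e _ => ?_)
  · obtain ⟨w, hw, -⟩ := hM (Set.mem_toFinset.1 hv)
    exact Finset.mem_biUnion.2 ⟨s(v, w), by simpa using hw, by simp⟩
  · rw [Sym2.card_toFinset]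
    split_ifs <;> omega

theorem SimpleGraph.degree_le_degree_induce_add {V : Type*} [Fintype V] (G : SimpleGraph V)
    (s : Set V) (v : s) [Fintype (G.neighborSet v)] [Fintype ((G.induce s).neighborSet v)] :
    G.degree v ≤ (G.induce s).degree v + sᶜ.ncard := by
  classical
  rw [← card_neighborFinset_eq_degree, ← card_neighborFinset_eq_degree,
    Set.ncard_eq_toFinset_card',
    ← Finset.card_map (Function.Embedding.subtype (· ∈ s)) (s := (G.induce s).neighborFinset v)]
  refine (Finset.card_le_card fun w hw => ?_).trans (Finset.card_union_le _ _)
  by_cases h : w ∈ s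
  · exact Finset.mem_union_left _ (Finset.mem_map.2 ⟨⟨w, h⟩, by simpa using hw, rfl⟩)
  · exact Finset.mem_union_right _ (by simpa using h)

/-- A matching together with an involution pairing up the remaining vertices along edges
extends to a perfect matching. -/
theorem SimpleGraph.Subgraph.IsMatching.exists_isPerfectMatching_of_involutive {V : Type*}
    {G : SimpleGraph V} {M : G.Subgraph} (hM : M.IsMatching)
    {f : ↥(M.vertsᶜ) → ↥(M.vertsᶜ)} (hf : Function.Involutive f)
    (hadj : ∀ v : ↥(M.vertsᶜ), G.Adj v (f v)) : ∃ P : G.Subgraph, P.IsPerfectMatching ∧ M ≤ P := by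
  refine ⟨⟨Set.univ, fun a b => M.Adj a b ∨ ∃ h : a ∈ M.vertsᶜ, (f ⟨a, h⟩ : V) = b, ?_, ?_, ?_⟩,
    ⟨fun v _ => ?_, fun v => Set.mem_univ v⟩, ⟨Set.subset_univ _, fun a b h => Or.inl h⟩⟩
  · rintro a b (h | ⟨h, rfl⟩)
    · exact h.adj_sub
    · exact hadj ⟨a, h⟩
  · intros
    trivial
  · refine ⟨fun a b => ?_⟩
    rintro (h | ⟨h, rfl⟩)
    · exact Or.inl h.symm
    · exact Or.inr ⟨(f ⟨a, h⟩).2, by simp [hf ⟨a, h⟩]⟩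
  · by_cases hv : v ∈ M.verts
    · obtain ⟨w, hw, huniq⟩ := hM hv
      exact ⟨w, Or.inl hw, by
        rintro z (h | ⟨h, -⟩)
        exacts [huniq z h, (h hv).elim]⟩
    · exact ⟨f ⟨v, hv⟩, Or.inr ⟨hv, rfl⟩, by
        rintro z (h | ⟨_, h⟩)
        exacts [(hv h.fst_mem).elim, h.symm]⟩

theorem SimpleGraph.Subgraph.IsMatching.exists_isPerfectMatching_of_degree {V : Type*} [Fintype V]
    {G : SimpleGraph V} [∀ v, Fintype (G.neighborSet v)] {n k : ℕ} (hn : Fintype.card V = 2 * n) (hkn : k + 2 ≤ n)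
    (hdeg : ∀ v, n + k ≤ G.degree v + 1)
    (hdef : ∀ x y z, x ≠ y → y ≠ z → x ≠ z →
      n + k ≤ G.degree x ∨ n + k ≤ G.degree y ∨ n + k ≤ G.degree z)
    {M : G.Subgraph} (hM : M.IsMatching) (hMk : M.edgeSet.ncard ≤ k) :
    ∃ P : G.Subgraph, P.IsPerfectMatching ∧ M ≤ P := by
  classical
  obtain ⟨j, hj⟩ := hM.even_card
  rw [← Set.ncard_eq_toFinset_card'] at hj
  have hle := Subgraph.ncard_verts_le_of_isMatching hM
  have hcard : Fintype.card ↥(M.vertsᶜ) = 2 * (n - j) := by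
    have := Set.ncard_add_ncard_compl M.verts
    rw [Nat.card_eq_fintype_card, hn] at this
    rw [← Nat.card_eq_fintype_card, Nat.card_coe_set_eq]
    omega
  have hind := fun v => G.degree_le_degree_induce_add M.vertsᶜ v
  rw [compl_compl] at hind
  obtain ⟨f, hf, hadj⟩ := exists_involution_adj (G.induce M.vertsᶜ) (n - j) (by omega) hcard
    (fun v => by have := hind v; have := hdeg v; omega)
    (fun x y z hxy hyz hxz => by
      have := hind x
      have := hind y
      have := hind z
      have := hdef x y z (by simpa [Subtype.ext_iff] using hxy)
        (by simpa [Subtype.ext_iff] using hyz) (by simpa [Subtype.ext_iff] using hxz)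
      omega)
  exact hM.exists_isPerfectMatching_of_involutive hf hadj

theorem SimpleGraph.connected_of_card_le_two_mul_degree {V : Type*} [Fintype V] [Nonempty V]
    {G : SimpleGraph V} [∀ v, Fintype (G.neighborSet v)]
    (h : ∀ v, Fintype.card V ≤ 2 * G.degree v) : G.Connected := by
  classical
  refine ⟨fun a b => ?_⟩
  by_cases hab : G.Adj a b
  · exact hab.reachable
  by_cases hne : a = b
  · exact hne ▸ Reachable.refl a
  obtain ⟨c, hc⟩ : (G.neighborFinset a ∩ G.neighborFinset b).Nonempty := by
    rw [← Finset.card_pos]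
    have hunion : G.neighborFinset a ∪ G.neighborFinset b ⊆ Finset.univ.erase a := by
      intro c hc
      refine Finset.mem_erase.2 ⟨?_, Finset.mem_univ c⟩
      rintro rfl
      simp [G.adj_comm b c, hab] at hc
    have h1 := Finset.card_le_card hunion
    have h2 := Finset.card_union_add_card_inter (G.neighborFinset a) (G.neighborFinset b)
    rw [Finset.card_erase_of_mem (Finset.mem_univ a), Finset.card_univ] at h1
    simp only [card_neighborFinset_eq_degree] at h2
    have := h a
    have := h b
    have := Fintype.card_pos (α := V)
    omega
  simp only [Finset.mem_inter, mem_neighborFinset] at hc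
  exact hc.1.reachable.trans hc.2.symm.reachable

theorem kExt_of_degree {V : Type*} [Fintype V] {G : SimpleGraph V}
    [∀ v, Fintype (G.neighborSet v)] {n k : ℕ}
    (hn : Fintype.card V = 2 * n) (hk : 1 ≤ k) (hkn : k + 2 ≤ n)
    (hdeg : ∀ v, n + k ≤ G.degree v + 1)
    (hdef : ∀ x y z, x ≠ y → y ≠ z → x ≠ z →
      n + k ≤ G.degree x ∨ n + k ≤ G.degree y ∨ n + k ≤ G.degree z) : KExt G k := by
  have : Nonempty V := Fintype.card_pos_iff.1 (by omega)
  have hext := fun M : G.Subgraph => Subgraph.IsMatching.exists_isPerfectMatching_of_degree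
    hn hkn hdeg hdef (M := M)
  refine ⟨connected_of_card_le_two_mul_degree fun v => ?_, ?_, fun M hM hMk => hext M hM hMk.le⟩
  · have := hdeg v
    omega
  · obtain ⟨P, hP, -⟩ := hext ⊥ (fun v hv => hv.elim) (by simp)
    exact ⟨P, hP⟩

theorem SimpleGraph.degree_le_degree_deleteEdges_add_one {V : Type*}
    (G : SimpleGraph V) (u v w : V) [Fintype (G.neighborSet w)]
    [Fintype ((G.deleteEdges {s(u, v)}).neighborSet w)] :
    G.degree w ≤ (G.deleteEdges {s(u, v)}).degree w + 1 := by
  classical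
  simp only [← card_neighborFinset_eq_degree]
  refine (Finset.card_le_card (t := insert (if w = u then v else u) _) fun z hz => ?_).trans
    (Finset.card_insert_le _ _)
  simp only [Finset.mem_insert, mem_neighborFinset, deleteEdges_adj, Set.mem_singleton_iff,
    Sym2.eq_iff] at hz ⊢
  grind

theorem SimpleGraph.degree_le_degree_deleteEdges {V : Type*}
    (G : SimpleGraph V) {u v w : V} [Fintype (G.neighborSet w)]
    [Fintype ((G.deleteEdges {s(u, v)}).neighborSet w)] (hu : w ≠ u) (hv : w ≠ v) :
    G.degree w ≤ (G.deleteEdges {s(u, v)}).degree w := by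
  simp only [← card_neighborFinset_eq_degree]
  refine Finset.card_le_card fun z hz => ?_
  simp only [mem_neighborFinset, deleteEdges_adj, Set.mem_singleton_iff, Sym2.eq_iff] at hz ⊢
  grind

theorem SimpleGraph.eq_top_of_card_le_degree_add_one {V : Type*} [Fintype V]
    {G : SimpleGraph V} [∀ v, Fintype (G.neighborSet v)]
    (h : ∀ v, Fintype.card V ≤ G.degree v + 1) : G = ⊤ := by
  classical
  refine eq_top_iff.2 fun a b hab => ?_
  have huniv : insert a (G.neighborFinset a) = Finset.univ := Finset.eq_univ_of_card _ <|
    (Finset.card_le_univ _).antisymm <| by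
      rw [Finset.card_insert_of_notMem (by simp), card_neighborFinset_eq_degree]
      exact h a
  have hb : b ∈ insert a (G.neighborFinset a) := huniv.symm ▸ Finset.mem_univ b
  simpa [hab.ne'] using hb

theorem stmt3 {V : Type*} [Fintype V] (G : SimpleGraph V) [DecidableRel G.Adj] (n k : ℕ)
    (hn : Fintype.card V = 2 * n) (hk : 1 ≤ k) (hkn : k ≤ n - 1)
    (hmin : MinimalKExt G k) (hne : G ≠ ⊤) :
    G.minDegree ≤ n + k - 1 := by
  classical
  by_contra! hlt
  have hdeg : ∀ v, n + k ≤ G.degree v := fun v => by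
    have := G.minDegree_le_degree v
    omega
  have hkn' : k + 2 ≤ n := by
    by_contra! h
    refine hne (eq_top_of_card_le_degree_add_one fun v => ?_)
    have := hdeg v
    omega
  obtain ⟨u⟩ : Nonempty V := Fintype.card_pos_iff.1 (by omega)
  obtain ⟨v, huv⟩ : ∃ v, G.Adj u v := (G.degree_pos_iff_exists_adj u).1 (by
    have := hdeg u
    omega)
  refine hmin.2 s(u, v) huv (kExt_of_degree hn hk hkn'
    (fun w => (hdeg w).trans (G.degree_le_degree_deleteEdges_add_one u v w))
    fun x y z hxy hyz hxz => ?_)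
  have hd : ∀ w, (G.deleteEdges {s(u, v)}).degree w < n + k → w = u ∨ w = v := fun w hw => by
    by_contra! h
    exact hw.not_ge ((hdeg w).trans (G.degree_le_degree_deleteEdges h.1 h.2))
  by_contra! h
  have hx := hd x h.1
  have hy := hd y h.2.1
  have hz := hd z h.2.2
  clear h hd
  grind
end

section
/- Let G be a finite simple graph of order 2n that is a minimal k-extendable graph for an integer k with 1 ≤ k ≤ n−1. Then either k+1 ≤ δ(G) ≤ n, or δ(G) ≥ 2k+1. -/
open SimpleGraph

namespace SimpleGraph

open Finset

variable {V : Type*} {G : SimpleGraph V} {W A B : Finset V} {f : V → V} {x y v : V} {k : ℕ}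

/-- The involution `f` matches the vertices of `W` among themselves along edges of `G`. -/
def MatchesOn (G : SimpleGraph V) (W : Finset V) (f : V → V) : Prop :=
  ∀ x ∈ W, f x ∈ W ∧ f (f x) = x ∧ G.Adj x (f x)

/-- The subgraph of `G` induced by `W` has a perfect matching. -/
def Matchable (G : SimpleGraph V) (W : Finset V) : Prop :=
  ∃ f, G.MatchesOn W f

lemma MatchesOn.image_subset [DecidableEq V] (h : G.MatchesOn W f) (hA : A ⊆ W) :
    A.image f ⊆ W := by
  intro x hx
  obtain ⟨y, hy, rfl⟩ := Finset.mem_image.1 hx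
  exact (h y (hA hy)).1

lemma MatchesOn.injOn (h : G.MatchesOn W f) : Set.InjOn f W := by
  intro x hx y hy hxy
  rw [← (h x hx).2.1, ← (h y hy).2.1, hxy]

/-- The subgraph formed by the edges of a matching of `W`. -/
def MatchesOn.subgraph (h : G.MatchesOn W f) : G.Subgraph where
  verts := W
  Adj x y := x ∈ W ∧ f x = y
  adj_sub := by
    rintro x y ⟨hx, rfl⟩
    exact (h x hx).2.2
  edge_vert := And.left
  symm := ⟨by
    rintro x y ⟨hx, rfl⟩
    exact ⟨(h x hx).1, (h x hx).2.1⟩⟩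

lemma MatchesOn.isMatching_subgraph (h : G.MatchesOn W f) : h.subgraph.IsMatching :=
  fun x hx ↦ ⟨f x, ⟨hx, rfl⟩, fun _ hy ↦ hy.2.symm⟩

lemma Subgraph.IsPerfectMatching.exists_mate {P : G.Subgraph} (hP : P.IsPerfectMatching) :
    ∃ g : V → V, ∀ x y, P.Adj x y ↔ g x = y := by
  choose g hg hu using fun x ↦ hP.1 (hP.2 x)
  exact ⟨g, fun x y ↦ ⟨fun h ↦ (hu x y h).symm, fun h ↦ h ▸ hg x⟩⟩

lemma _root_.KExt.matchable_univ [Fintype V] (h : KExt G k) : G.Matchable univ := by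
  obtain ⟨P, hP⟩ := h.2.1
  obtain ⟨g, hg⟩ := hP.exists_mate
  refine ⟨g, fun x _ ↦ ⟨mem_univ _, ?_, ?_⟩⟩
  · exact (hg _ _).1 ((hg x _).2 rfl).symm
  · exact ((hg x _).2 rfl).adj_sub

variable [DecidableEq V]

lemma matchable_pair (h : G.Adj x y) : G.Matchable {x, y} := by
  refine ⟨Equiv.swap x y, ?_⟩
  have := h.symm
  intro z hz
  rcases Finset.mem_insert.1 hz with rfl | hz
  · simpa
  · obtain rfl := Finset.mem_singleton.1 hz
    simpa

lemma Matchable.union (hA : G.Matchable A) (hB : G.Matchable B) (hd : Disjoint A B) :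
    G.Matchable (A ∪ B) := by
  obtain ⟨f, hf⟩ := hA
  obtain ⟨g, hg⟩ := hB
  refine ⟨fun x ↦ if x ∈ A then f x else g x, fun x hx ↦ ?_⟩
  by_cases hxA : x ∈ A
  · have := hf x hxA
    simp_all
  · have hxB : x ∈ B := by simpa [hxA] using hx
    have := hg x hxB
    have : g x ∉ A := Finset.disjoint_right.1 hd this.1
    simp_all

lemma Matchable.insert_insert (hW : G.Matchable W) (h : G.Adj x y) (hx : x ∉ W) (hy : y ∉ W) :
    G.Matchable (insert x (insert y W)) := by
  have := (matchable_pair h).union hW (by simp [hx, hy])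
  convert this using 1
  grind

lemma MatchesOn.matchable_sdiff (h : G.MatchesOn W f) (x : V) (hx : x ∈ W) :
    G.Matchable (W \ {x, f x}) := by
  refine ⟨f, fun y hy ↦ ?_⟩
  have h1 := h x hx
  have h2 := h y (by grind)
  grind

/-- Augmentation along a path of length three. -/
lemma MatchesOn.matchable_augment (h : G.MatchesOn W f) {a : V} (ha : a ∈ W)
    (hx : x ∉ W) (hy : y ∉ W) (hxy : x ≠ y) (hxa : G.Adj x a) (hya : G.Adj y (f a)) :
    G.Matchable (insert x (insert y W)) := by
  obtain ⟨h1, h2, h3⟩ := h a ha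
  have h3 := h3.ne
  have := ((h.matchable_sdiff a ha).insert_insert hya (by grind) (by grind)).insert_insert hxa
    (by grind) (by grind)
  convert this using 1
  grind

lemma Matchable.even_card (h : G.Matchable W) : Even #W := by
  induction hn : #W using Nat.strong_induction_on generalizing W with
  | _ m ih =>
    obtain rfl | ⟨x, hx⟩ := W.eq_empty_or_nonempty
    · simp [← hn]
    · obtain ⟨f, hf⟩ := h
      obtain ⟨h1, h2, h3⟩ := hf x hx
      have hc := card_sdiff_add_card_eq_card (s := {x, f x}) (t := W) (by grind)
      rw [card_pair h3.ne] at hc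
      have := ih _ (by omega) (hf.matchable_sdiff x hx) rfl
      grind

lemma Matchable.exists_subset_card (h : G.Matchable W) {t : ℕ} (ht : 2 * t ≤ #W) :
    ∃ C ⊆ W, #C = 2 * t ∧ G.Matchable C := by
  induction hn : #W using Nat.strong_induction_on generalizing W with
  | _ m ih =>
    by_cases hm : m = 2 * t
    · exact ⟨W, subset_rfl, by omega, h⟩
    have he := h.even_card
    obtain ⟨x, hx⟩ : W.Nonempty := by
      rw [← card_pos]; omega
    obtain ⟨f, hf⟩ := h
    obtain ⟨h1, h2, h3⟩ := hf x hx
    have hc := card_sdiff_add_card_eq_card (s := {x, f x}) (t := W) (by grind)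
    rw [card_pair h3.ne] at hc
    obtain ⟨C, hC, h⟩ := ih _ (by omega) (hf.matchable_sdiff x hx) (by grind) rfl
    exact ⟨C, hC.trans sdiff_subset, h⟩

/-- If a property of finsets of a fixed size is not constant, it changes under the exchange
of some single element. -/
lemma exists_exchange {p : Finset V → Prop} (hA : p A) (hB : ¬ p B) (hAB : #A = #B) :
    ∃ S x y, x ∉ S ∧ y ∉ S ∧ p (insert y S) ∧ ¬ p (insert x S) ∧ #S + 1 = #A := by
  induction hn : #(A \ B) generalizing A with
  | zero =>
    have := eq_of_subset_of_card_le (sdiff_eq_empty_iff_subset.1 (card_eq_zero.1 hn)) hAB.ge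
    exact absurd (this ▸ hA) hB
  | succ m ih =>
    obtain ⟨y, hy⟩ : (A \ B).Nonempty := by rw [← card_pos]; omega
    obtain ⟨x, hx⟩ : (B \ A).Nonempty := by
      rw [← card_pos, ← card_sdiff_comm hAB]; omega
    simp only [mem_sdiff] at hx hy
    have hc : #(insert x (A.erase y)) = #A := by
      rw [card_insert_of_notMem (by grind), card_erase_add_one hy.1]
    by_cases hp : p (insert x (A.erase y))
    · have := ih hp (hc.trans hAB) (by
        rw [show insert x (A.erase y) \ B = (A \ B).erase y by
            clear ih; ext z; simp only [mem_sdiff, mem_insert, mem_erase]; grind,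
          card_erase_of_mem (by grind), hn]
        rfl)
      rwa [hc] at this
    · exact ⟨A.erase y, x, y, by grind, by grind, by rwa [insert_erase hy.1], hp,
        card_erase_add_one hy.1⟩

variable [Fintype V]

lemma MatchesOn.two_mul_ncard_edgeSet (h : G.MatchesOn W f) :
    2 * h.subgraph.edgeSet.ncard = #W := by
  classical
  have key := h.subgraph.spanningCoe.sum_degrees_eq_twice_card_edges
  have hd (x : V) : h.subgraph.spanningCoe.degree x = if x ∈ W then 1 else 0 := by
    rw [← card_neighborFinset_eq_degree]
    split_ifs with hx
    · refine card_eq_one.2 ⟨f x, ?_⟩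
      ext y
      rw [mem_neighborFinset]
      simp [subgraph, hx, eq_comm]
    · refine card_eq_zero.2 ?_
      ext y
      rw [mem_neighborFinset]
      simp [subgraph, hx]
  rw [← Subgraph.edgeSet_spanningCoe, ← coe_edgeFinset, Set.ncard_coe_finset, ← key]
  simp [hd]

lemma _root_.KExt.matchable_compl (h : KExt G k) (hW : G.Matchable W) (hc : #W = 2 * k) :
    G.Matchable Wᶜ := by
  obtain ⟨f, hf⟩ := hW
  obtain ⟨P, hP, hle⟩ := h.2.2 hf.subgraph hf.isMatching_subgraph
    (by have := hf.two_mul_ncard_edgeSet; omega)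
  obtain ⟨g, hg⟩ := hP.exists_mate
  have hgg (x) : g (g x) = x := (hg _ _).1 ((hg x _).2 rfl).symm
  have hfg (x) (hx : x ∈ W) : g x = f x := (hg _ _).1 (hle.2 ⟨hx, rfl⟩)
  refine ⟨g, fun x hx ↦ ⟨?_, hgg x, ((hg x _).2 rfl).adj_sub⟩⟩
  rw [mem_compl] at hx ⊢
  intro hgx
  have := (hf _ hgx).1
  rw [← hfg _ hgx, hgg] at this
  exact hx this

/-- Every vertex of a `k`-extendable graph has degree at least `k + 1`. -/
lemma _root_.KExt.lt_degree [DecidableRel G.Adj] (h : KExt G k)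
    (hk : 2 * k + 2 ≤ Fintype.card V) (v : V) : k < G.degree v := by
  by_contra! hd
  obtain ⟨f, hf⟩ := h.matchable_univ
  simp only [MatchesOn, mem_univ, true_and, forall_const] at hf
  set N := (G.neighborFinset v).erase (f v) with hN
  set A := N ∪ N.image f with hA
  have hNv (x) : x ∈ N ↔ x ≠ f v ∧ G.Adj v x := by simp [hN]
  have hAf (x) : x ∈ A ↔ x ∈ N ∨ f x ∈ N := by
    have := hf x
    have hff (y) := (hf y).1
    simp only [hA, mem_union, mem_image]
    grind
  have hff (x) : f (f x) = x := (hf x).1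
  have hadj (x) : G.Adj x (f x) := (hf x).2
  have hfA (x) : f x ∈ A ↔ x ∈ A := by grind
  have hvA : v ∉ A := by
    have := G.loopless.irrefl v
    grind
  have huA : f v ∉ A := by grind
  have hcard : #A ≤ 2 * (k - 1) := by
    have h1 := card_union_le N (N.image f)
    rw [← hA] at h1
    have h2 := card_image_le (s := N) (f := f)
    have h3 : #N = G.degree v - 1 := by
      rw [hN, card_erase_of_mem (by simpa using hadj v), card_neighborFinset_eq_degree]
    omega
  have hdpos : 0 < k := by
    have : 0 < G.degree v := (G.degree_pos_iff_exists_adj v).2 ⟨_, hadj v⟩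
    omega
  clear_value A N
  clear hA hN
  have hmA : G.Matchable A := ⟨f, fun x hx ↦ ⟨(hfA x).2 hx, hf x⟩⟩
  have heven := hmA.even_card
  have hne := (hadj v).ne
  -- a matching of the appropriate size can be completed to size `k` away from `v` and `f v`
  have fill (z) (hz : z ∉ A) (hzv : z ≠ v) (hzu : z ≠ f v) (U : Finset V) (hU : G.Matchable U)
      (hUA : U ⊆ insert z (insert v (insert (f v) A))) (hUc : #U = #A + 2) :
      ∃ W, U ⊆ W ∧ W ∩ (insert v (insert (f v) A)) ⊆ U ∧ G.Matchable Wᶜ := by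
    set A' := insert z (insert (f z) (insert v (insert (f v) A)))
    have hz' : z ≠ f z := (hadj z).ne
    have hcA' : #A' = #A + 4 := by
      rw [card_insert_of_notMem (by grind), card_insert_of_notMem (by grind),
        card_insert_of_notMem (by grind), card_insert_of_notMem (by grind)]
    have hB : G.Matchable A'ᶜ := ⟨f, fun x hx ↦ ⟨by simp only [mem_compl] at hx ⊢; grind, hf x⟩⟩
    obtain ⟨C, hCs, hCc, hC⟩ := hB.exists_subset_card (t := (2 * k - #U) / 2)
      (by rw [card_compl]; omega)
    have hCA (x) (hx : x ∈ C) : x ∉ A' := by simpa using hCs hx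
    have hdisj : Disjoint U C := by
      rw [Finset.disjoint_left]
      grind
    refine ⟨U ∪ C, subset_union_left, by grind, h.matchable_compl (hU.union hC hdisj) ?_⟩
    rw [card_union_of_disjoint hdisj]
    grind
  have mate {W : Finset V} (hW : G.Matchable Wᶜ) (x) (hx : x ∉ W) : ∃ y ∉ W, G.Adj x y := by
    obtain ⟨g, hg⟩ := hW
    have := hg x (by simpa)
    exact ⟨g x, by simpa using this.1, this.2.2⟩
  have hu (z) (hz : z ∉ A) (hzv : z ≠ v) : ¬ G.Adj (f v) z := by
    intro huz
    obtain ⟨W, hUW, hWU, hW⟩ := fill z hz hzv huz.ne' _ (hmA.insert_insert huz huA hz)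
      (by grind) (by
        rw [card_insert_of_notMem (by have := huz.ne; grind), card_insert_of_notMem hz])
    obtain ⟨y, hy, hvy⟩ := mate hW v (by have := huz.ne; grind)
    grind
  have hw (w) (hw : w ∈ N) (z) (hz : z ∉ A) (hzv : z ≠ v) (hzu : z ≠ f v) :
      ¬ G.Adj (f w) z := by
    intro hwz
    have hwA : w ∈ A := (hAf w).2 (Or.inl hw)
    obtain ⟨W, hUW, hWU, hW⟩ := fill z hz hzv hzu (insert v (insert z A))
      ((show G.MatchesOn A f from fun x hx ↦ ⟨(hfA x).2 hx, hf x⟩).matchable_augment hwA hvA hz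
        hzv.symm ((hNv w).1 hw).2 hwz.symm)
      (by grind) (by
        rw [card_insert_of_notMem (by grind), card_insert_of_notMem hz])
    obtain ⟨y, hy, hvy⟩ := mate hW (f v) (by grind)
    exact hu y (by grind) (by grind) hvy
  have hw' (w) (hwN : w ∈ N) (z) (hz : z ∉ A) (hzv : z ≠ v) (hzu : z ≠ f v) :
      ¬ G.Adj w z := by
    intro hwz
    have hwA : w ∈ A := (hAf w).2 (Or.inl hwN)
    have hwf := (hadj w).ne
    have hU : G.Matchable (insert v (insert (f v) (insert w (insert z (A \ {w, f w}))))) :=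
      ((MatchesOn.matchable_sdiff (fun x hx ↦ ⟨(hfA x).2 hx, hf x⟩) w hwA).insert_insert hwz
        (by grind) (by grind)).insert_insert (hadj v) (by grind) (by grind)
    obtain ⟨W, hUW, hWU, hW⟩ := fill z hz hzv hzu _ hU
      (by grind) (by
        have := card_sdiff_add_card_eq_card (s := {w, f w}) (t := A) (by grind)
        rw [card_pair hwf] at this
        rw [card_insert_of_notMem (by grind), card_insert_of_notMem (by grind),
          card_insert_of_notMem (by grind), card_insert_of_notMem (by grind)]
        omega)
    have hfwA : f w ∈ A := (hfA w).2 hwA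
    have hfwW : f w ∉ W := by
      intro hmem
      have := hWU (mem_inter.2 ⟨hmem, by simp [hfwA]⟩)
      simp only [mem_insert, mem_sdiff, mem_singleton] at this
      grind
    obtain ⟨y, hy, hfy⟩ := mate hW (f w) hfwW
    have hyU := mt (@hUW y) hy
    have := hfy.ne
    simp only [mem_insert, mem_sdiff, mem_singleton] at hyU
    exact hw w hwN y (by grind) (by grind) (by grind) hfy
  obtain ⟨z, hz⟩ : (insert v (insert (f v) A))ᶜ.Nonempty := by
    rw [← card_pos, card_compl, card_insert_of_notMem (by grind), card_insert_of_notMem huA]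
    omega
  have closed (x y) (hxy : G.Adj x y) (hx : x ∈ (insert v (insert (f v) A))ᶜ) :
      y ∈ (insert v (insert (f v) A))ᶜ := by
    simp only [mem_compl, mem_insert, not_or] at hx ⊢
    obtain ⟨hxv, hxu, hxA⟩ := hx
    refine ⟨?_, ?_, fun hyA ↦ ?_⟩
    · rintro rfl
      exact hxA ((hAf x).2 (Or.inl ((hNv x).2 ⟨hxu, hxy.symm⟩)))
    · rintro rfl
      exact hu x hxA hxv hxy.symm
    · rcases (hAf y).1 hyA with hy | hy
      · exact hw' y hy x hxA hxv hxu hxy.symm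
      · exact hw (f y) hy x hxA hxv hxu (by rw [hff]; exact hxy.symm)
  obtain ⟨p⟩ := h.1.preconnected z v
  have walk_closed {x y : V} (p : G.Walk x y) (hx : x ∈ (insert v (insert (f v) A))ᶜ) :
      y ∈ (insert v (insert (f v) A))ᶜ := by
    induction p with
    | nil => exact hx
    | cons hab _ ih => exact ih (closed _ _ hab hx)
  have := walk_closed p hz
  simp at this

/-- Two vertices whose neighborhoods in `W` are large see the two ends of a matching edge. -/
lemma MatchesOn.exists_adj_adj [DecidableRel G.Adj] (h : G.MatchesOn W f)
    (hx : G.neighborFinset x ⊆ W) (hy : G.neighborFinset y ⊆ W)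
    (hc : #W < G.degree x + G.degree y) : ∃ a ∈ W, G.Adj x a ∧ G.Adj y (f a) := by
  obtain ⟨a, ha⟩ := inter_nonempty_of_card_lt_card_add_card hx (h.image_subset hy) (by
    rwa [card_image_of_injOn (h.injOn.mono (mod_cast hy)), card_neighborFinset_eq_degree,
      card_neighborFinset_eq_degree])
  simp only [mem_inter, mem_image, mem_neighborFinset] at ha
  obtain ⟨ha, b, hb, rfl⟩ := ha
  have hbW : b ∈ W := hy (by simpa)
  exact ⟨f b, (h b hbW).1, ha, by rwa [(h b hbW).2.1]⟩

/-- In a `k`-extendable graph of large minimum degree, smaller matchings extend as well. -/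
lemma _root_.KExt.matchable_compl_of_le [DecidableRel G.Adj] (h : KExt G k)
    (hk : 2 * k + 2 ≤ Fintype.card V) (hd : ∀ v, Fintype.card V < 2 * G.degree v) {j : ℕ}
    (hj : j ≤ k) (hW : G.Matchable W) (hc : #W = 2 * j) : G.Matchable Wᶜ := by
  induction hj using Nat.decreasingInduction generalizing W with
  | self => exact h.matchable_compl hW hc
  | of_succ j hj ih =>
    by_cases hE : ∃ x ∉ W, ∃ y ∉ W, G.Adj x y
    · obtain ⟨x, hx, y, hy, hxy⟩ := hE
      have hne := hxy.ne
      have := (ih (hW.insert_insert hxy hx hy) (by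
        rw [card_insert_of_notMem (by grind), card_insert_of_notMem hy]; omega)).insert_insert
        hxy (by simp) (by simp)
      convert this using 1
      ext z
      simp only [mem_insert, mem_compl]
      grind
    push Not at hE
    exfalso
    obtain ⟨f, hf⟩ := hW
    have hN (x) (hx : x ∉ W) : G.neighborFinset x ⊆ W := by
      intro y hy
      by_contra hyW
      exact hE x hx y hyW (by simpa using hy)
    obtain ⟨x, hx, y, hy, hxy⟩ := one_lt_card.1 (show 1 < #Wᶜ by rw [card_compl]; omega)
    rw [mem_compl] at hx hy
    obtain ⟨a, ha, hxa, hya⟩ := hf.exists_adj_adj (hN x hx) (hN y hy) (by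
      have := hd x; have := hd y; omega)
    have hc' : #(insert x (insert y W)) = 2 * (j + 1) := by
      rw [card_insert_of_notMem (by grind), card_insert_of_notMem hy]; omega
    obtain ⟨g, hg⟩ := ih (hf.matchable_augment ha hx hy hxy hxa hya) hc'
    obtain ⟨z, hz⟩ : (insert x (insert y W))ᶜ.Nonempty := by
      rw [← card_pos, card_compl]; omega
    have := hg z hz
    simp only [mem_compl, mem_insert, not_or] at hz this
    exact hE z hz.2.2 _ this.1.2.2 this.2.2

/-- A `k`-extendable graph on `2 * n ≤ 4 * k - 2` vertices with minimum degree larger than `n` is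
`2 * k`-factor-critical. -/
lemma _root_.KExt.matchable_of_card [DecidableRel G.Adj] (h : KExt G k) {n : ℕ}
    (hn : Fintype.card V = 2 * n) (hkn : k < n) (hnk : n + 1 ≤ 2 * k)
    (hd : ∀ v, n < G.degree v) (hW : #W = 2 * (n - k)) : G.Matchable W := by
  by_contra hnW
  have hext {W : Finset V} {j : ℕ} (hj : j ≤ k) (hW : G.Matchable W) (hc : #W = 2 * j) :
      G.Matchable Wᶜ :=
    h.matchable_compl_of_le (by omega) (fun v ↦ by have := hd v; omega) hj hW hc
  obtain ⟨Z, -, hZc, hZ⟩ := h.matchable_univ.exists_subset_card (t := n - k)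
    (by rw [card_univ]; omega)
  obtain ⟨S, y, u, hyS, huS, ⟨f, hf⟩, hnot, hSc⟩ := exists_exchange hZ hnW (hZc.trans hW.symm)
  obtain ⟨hx, hxx, hux⟩ := hf u (mem_insert_self _ _)
  set x := f u
  have hxS : x ∈ S := mem_of_mem_insert_of_ne hx hux.ne'
  set N := S.erase x with hN
  have hSN : insert y S = insert y (insert x N) := by rw [insert_erase hxS]
  have hNm : G.Matchable N := by
    convert hf.matchable_sdiff u (mem_insert_self _ _) using 1
    grind
  have hNc : #N = 2 * (n - k - 1) := by rw [card_erase_of_mem hxS]; omega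
  have hxN : x ∉ N := by grind
  have hyN : y ∉ N := by grind
  have hxy : x ≠ y := by grind
  clear_value x N
  have hnadj : ¬ G.Adj x y := fun hadj ↦ hnot (by
    rw [hSN]; exact hNm.insert_insert hadj.symm hyN hxN)
  have hNcm := hext (by omega) hNm hNc
  obtain ⟨f, hf⟩ := hNm
  obtain ⟨g, hg⟩ := hNcm
  have hσ : G.MatchesOn univ fun z ↦ if z ∈ N then f z else g z := by
    intro z _
    have hf := hf z
    have hg := hg z
    simp only [mem_compl] at hg
    grind
  obtain ⟨a, -, hxa, hya⟩ := hσ.exists_adj_adj (x := x) (y := y) (subset_univ _) (subset_univ _)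
    (by have := hd x; have := hd y; rw [card_univ]; omega)
  split_ifs at hya with ha
  · refine hnot ?_
    rw [hSN, Finset.insert_comm]
    exact hf.matchable_augment ha hxN hyN hxy hxa hya
  · have hga := hg a (by simpa)
    rw [mem_compl] at hga
    obtain ⟨hgaN, -, hagadj⟩ := hga
    have hne := hagadj.ne
    have h1 := hxa.ne
    have h2 := hya.ne
    have h3 : a ≠ y := by rintro rfl; exact hnadj hxa
    have h4 : g a ≠ x := by rintro h; exact hnadj (h ▸ hya).symm
    have hm : G.Matchable (insert x (insert a (insert y (insert (g a) N)))) :=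
      (Matchable.insert_insert ⟨f, hf⟩ hya hyN hgaN).insert_insert hxa (by grind) (by grind)
    have hm' := (hext (j := n - k + 1) (by omega) hm (by
      rw [card_insert_of_notMem (by grind), card_insert_of_notMem (by grind),
        card_insert_of_notMem (by grind), card_insert_of_notMem hgaN]
      omega)).insert_insert hagadj (by simp) (by simp)
    have := hext le_rfl hm' (by
      rw [card_insert_of_notMem (by simp [hne]), card_insert_of_notMem (by simp), card_compl,
        card_insert_of_notMem (by grind), card_insert_of_notMem (by grind),
        card_insert_of_notMem (by grind), card_insert_of_notMem hgaN]
      omega)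
    refine hnot ?_
    convert this using 1
    ext z
    simp only [hSN, mem_insert, mem_compl]
    grind

/-- The minimum degree of a `k`-extendable graph on `2 * n` vertices. -/
lemma _root_.KExt.minDegree_dichotomy [DecidableRel G.Adj] (h : KExt G k) {n : ℕ}
    (hn : Fintype.card V = 2 * n) (hk : 1 ≤ k) (hkn : k ≤ n - 1) :
    (k + 1 ≤ G.minDegree ∧ G.minDegree ≤ n) ∨ 2 * k + 1 ≤ G.minDegree := by
  have : Nonempty V := h.1.nonempty
  obtain ⟨v, hv⟩ := G.exists_minimal_degree_vertex
  have hlow := h.lt_degree (by omega) v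
  by_contra! hcon
  have hdeg : n < G.minDegree := hcon.1 (by omega)
  have hc : 2 * (n - k) ≤ #(G.neighborFinset v)ᶜ := by
    rw [card_compl, card_neighborFinset_eq_degree]
    omega
  obtain ⟨W, hvW, hWN, hWc⟩ := exists_subsuperset_card_eq
    (s := {v}) (t := (G.neighborFinset v)ᶜ) (n := 2 * (n - k)) (by simp) (by simp; omega) hc
  obtain ⟨f, hf⟩ := h.matchable_of_card hn (by omega) (by omega)
    (fun u ↦ hdeg.trans_le (G.minDegree_le_degree u)) hWc
  have := hf v (hvW (by simp))
  have hfv := hWN this.1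
  simp only [mem_compl, mem_neighborFinset] at hfv
  exact hfv this.2.2

end SimpleGraph

theorem stmt4 {V : Type*} [Fintype V] (G : SimpleGraph V) [DecidableRel G.Adj] (n k : ℕ)
    (hn : Fintype.card V = 2 * n) (hk : 1 ≤ k) (hkn : k ≤ n - 1)
    (hmin : MinimalKExt G k) :
    (k + 1 ≤ G.minDegree ∧ G.minDegree ≤ n) ∨ 2 * k + 1 ≤ G.minDegree := by
  classical
  exact hmin.1.minDegree_dichotomy hn hk hkn
end

section
/- Let G be a finite simple graph of order 2n that is k-extendable for an integer k with 1 ≤ k ≤ n−1. Then G is a minimal k-extendable graph if and only if for every edge e = uv of G there exists a set S_e ⊆ V(G)∖{u, v} such that: (i) the induced subgraph G[S_e] has a matching of size at least k; (ii) the number of odd components of G_e := G − e − S_e equals |S_e| − 2k + 2; and (iii) u and v belong to two distinct odd components of G_e. -/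
open SimpleGraph

/-- The graph `G - e - S` obtained from `G` by deleting the edge `e = uv` and the vertices
of `S`. -/
def Ge {V : Type*} (G : SimpleGraph V) (u v : V) (S : Set V) : SimpleGraph ↑(Sᶜ) :=
  (G.deleteEdges {s(u, v)}).induce Sᶜ

/-- `S` is an admissible set for the edge `uv` (with parameter `k`): `S ⊆ V ∖ {u, v}`,
`G[S]` has a matching of size at least `k`, the number of odd components of `G - uv - S`
equals `|S| - 2k + 2`, and `u`, `v` lie in two distinct odd components of `G - uv - S`. -/
def Admissible {V : Type*} [Fintype V] (G : SimpleGraph V) (k : ℕ) (u v : V) (S : Set V) :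
    Prop :=
  u ∉ S ∧ v ∉ S ∧
  (∃ M : G.Subgraph, M.IsMatching ∧ M.verts ⊆ S ∧ k ≤ M.edgeSet.ncard) ∧
  Set.ncard {C : (Ge G u v S).ConnectedComponent | Odd C.supp.ncard} + 2 * k = S.ncard + 2 ∧
  ∃ (hu : u ∈ Sᶜ) (hv : v ∈ Sᶜ),
    (Ge G u v S).connectedComponentMk ⟨u, hu⟩ ≠ (Ge G u v S).connectedComponentMk ⟨v, hv⟩ ∧
    Odd ((Ge G u v S).connectedComponentMk ⟨u, hu⟩).supp.ncard ∧
    Odd ((Ge G u v S).connectedComponentMk ⟨v, hv⟩).supp.ncard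

namespace SimpleGraph

variable {V W : Type*} {G G' : SimpleGraph V}

lemma Iso.ncard_oddComponents_eq {H : SimpleGraph W} (φ : G ≃g H) :
    G.oddComponents.ncard = H.oddComponents.ncard := by
  have hodd (C : G.ConnectedComponent) :
      φ.connectedComponentEquiv C ∈ H.oddComponents ↔ C ∈ G.oddComponents := by
    have := Nat.card_congr (ConnectedComponent.isoEquivSupp φ C)
    simp only [Set.mem_ofPred_eq, ← Nat.card_coe_set_eq]
    rw [this]
  rw [← Set.ncard_preimage_of_injective_subset_range φ.connectedComponentEquiv.injective
    (s := H.oddComponents) (by simp)]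
  congr 1
  ext C
  exact (hodd C).symm

/-- Deleting two disjoint vertex sets one after the other amounts to deleting their union. -/
def deleteVertsInduceIso (G : SimpleGraph V) (W : Set V) (U : Set ↥(Wᶜ)) :
    ((⊤ : (G.induce Wᶜ).Subgraph).deleteVerts U).coe ≃g
      G.induce (W ∪ Subtype.val '' U)ᶜ where
  toFun x := ⟨x.1.1, by
    have h : x.1 ∉ U := x.2.2
    have h' : x.1.1 ∉ W := x.1.2
    simpa [h'] using h⟩
  invFun y := ⟨⟨y.1, fun h => y.2 (.inl h)⟩, trivial, fun h => y.2 (.inr ⟨_, h, rfl⟩)⟩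
  left_inv _ := rfl
  right_inv _ := rfl
  map_rel_iff' := by
    rintro ⟨x, hx⟩ ⟨y, hy⟩
    have hx' : x ∉ U := hx.2
    have hy' : y ∉ U := hy.2
    simp [hx', hy']

namespace Subgraph

lemma IsMatching.ncard_verts [Finite V] {M : G.Subgraph} (hM : M.IsMatching) :
    M.verts.ncard = 2 * M.edgeSet.ncard := by
  classical
  have := Fintype.ofFinite V
  rw [isMatching_iff_forall_degree] at hM
  have h := M.coe.sum_degrees_eq_twice_card_edges
  have hd (x : M.verts) [Fintype (M.coe.neighborSet x)] : M.coe.degree x = 1 := by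
    rw [M.coe_degree]
    convert hM x x.2
  simp only [hd] at h
  rw [← image_coe_edgeSet_coe, Set.ncard_image_of_injective _
    (Sym2.map.injective Subtype.val_injective), ← coe_edgeFinset, Set.ncard_coe_finset, ← h]
  simp [Set.ncard_eq_toFinset_card']

/-- The edges of a matching lying in a given set form a matching. -/
lemma IsMatching.exists_le_edgeSet_eq {M : G.Subgraph} (hM : M.IsMatching) {F : Set (Sym2 V)}
    (hF : F ⊆ M.edgeSet) :
    ∃ N ≤ M, N.IsMatching ∧ N.edgeSet = F ∧ ∀ v ∈ N.verts, ∃ e ∈ F, v ∈ e := by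
  have hadj {a b : V} (h : s(a, b) ∈ F) : M.Adj a b := hF h
  let N : G.Subgraph :=
    { verts := {v | ∃ w, s(v, w) ∈ F}
      Adj a b := s(a, b) ∈ F
      adj_sub h := (hadj h).adj_sub
      edge_vert h := ⟨_, h⟩
      symm := ⟨fun a b h => by rwa [Sym2.eq_swap]⟩ }
  refine ⟨N, ⟨fun v ⟨w, h⟩ => (hadj h).fst_mem, fun a b h => hadj h⟩, ?_, ?_, ?_⟩
  · rintro v ⟨w, h⟩
    exact ⟨w, h, fun y hy => hM.eq_of_adj_left (hadj hy) (hadj h)⟩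
  · ext e
    induction e with | _ a b => rfl
  · rintro v ⟨w, h⟩
    exact ⟨_, h, by simp⟩

lemma exists_isPerfectMatching_induce_iff {M : G.Subgraph} (hM : M.IsMatching) :
    (∃ Q : (G.induce M.vertsᶜ).Subgraph, Q.IsPerfectMatching) ↔
      ∃ P : G.Subgraph, P.IsPerfectMatching ∧ M ≤ P := by
  constructor
  · rintro ⟨Q, hQ⟩
    have hQm := hQ.1.map (Embedding.induce (G := G) M.vertsᶜ).toHom Subtype.val_injective
    refine ⟨M ⊔ Q.map _, ⟨hM.sup hQm ?_, fun v => ?_⟩, le_sup_left⟩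
    · rw [hM.support_eq_verts, hQm.support_eq_verts, Set.disjoint_left]
      rintro v hv ⟨x, -, rfl⟩
      exact x.2 hv
    · by_cases hv : v ∈ M.verts
      · exact .inl hv
      · exact .inr ⟨⟨v, hv⟩, hQ.2 _, rfl⟩
  · rintro ⟨P, hP, hMP⟩
    refine ⟨P.comap (Embedding.induce (G := G) M.vertsᶜ).toHom, isPerfectMatching_iff.2 ?_⟩
    rintro ⟨v, hv⟩
    obtain ⟨w, hw, hw'⟩ := isPerfectMatching_iff.1 hP v
    have hwM : w ∉ M.verts := fun h => by
      obtain ⟨x, hx, -⟩ := hM h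
      obtain rfl := hP.1.eq_of_adj_left (hMP.2 hx) hw.symm
      exact hv hx.snd_mem
    refine ⟨⟨w, hwM⟩, ⟨hw.adj_sub, hw⟩, fun y hy => Subtype.ext (hw' _ hy.2)⟩

/-- Tutte's theorem relative to a matching: a matching `M` extends to a perfect matching if and
only if the removal of any `S` containing the vertices of `M` leaves at most
`|S| - |V(M)|` odd components. -/
theorem exists_isPerfectMatching_ge_iff [Finite V] {M : G.Subgraph} (hM : M.IsMatching) :
    (∃ P : G.Subgraph, P.IsPerfectMatching ∧ M ≤ P) ↔
      ∀ S : Set V, M.verts ⊆ S →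
        (G.induce Sᶜ).oddComponents.ncard + M.verts.ncard ≤ S.ncard := by
  have hcard (U : Set ↥(M.vertsᶜ)) :
      (M.verts ∪ Subtype.val '' U).ncard = M.verts.ncard + U.ncard := by
    rw [Set.ncard_union_eq, Set.ncard_image_of_injective _ Subtype.val_injective]
    rw [Set.disjoint_left]
    rintro v hv ⟨x, -, rfl⟩
    exact x.2 hv
  rw [← exists_isPerfectMatching_induce_iff hM, tutte]
  unfold IsTutteViolator
  simp only [(deleteVertsInduceIso G M.verts _).ncard_oddComponents_eq, not_lt]
  constructor
  · intro h S hS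
    have hSU : M.verts ∪ Subtype.val '' (Subtype.val ⁻¹' S : Set ↥(M.vertsᶜ)) = S := by
      rw [Subtype.image_preimage_coe]
      ext v
      have := @hS v
      by_cases hv : v ∈ M.verts <;> simp_all
    have h1 := h (Subtype.val ⁻¹' S)
    have h2 := hcard (Subtype.val ⁻¹' S)
    rw [hSU] at h1 h2
    omega
  · intro h U
    have := h (M.verts ∪ Subtype.val '' U) Set.subset_union_left
    rw [hcard] at this
    omega

end Subgraph

lemma induce_compl_deleteEdges_eq {S : Set V} {u v : V} (h : u ∈ S ∨ v ∈ S) :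
    (G.deleteEdges {s(u, v)}).induce Sᶜ = G.induce Sᶜ := by
  ext ⟨a, ha⟩ ⟨b, hb⟩
  simp only [comap_adj, deleteEdges_adj, Function.Embedding.subtype_apply, and_iff_left_iff_imp,
    Set.mem_singleton_iff, Sym2.eq_iff]
  rintro - (⟨rfl, rfl⟩ | ⟨rfl, rfl⟩) <;> simp_all

/-- If adding the edge `uv` reduces the number of odd components by at least two, then it reduces
it by exactly two, and `u`, `v` lie in distinct odd components. -/
lemma odd_components_of_ncard_add_two_le [Finite V] {u v : V} (hle : G ≤ G')
    (hadj : ∀ a b, G'.Adj a b → G.Adj a b ∨ s(a, b) = s(u, v))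
    (h : G'.oddComponents.ncard + 2 ≤ G.oddComponents.ncard) :
    G.oddComponents.ncard = G'.oddComponents.ncard + 2 ∧
      G.connectedComponentMk u ≠ G.connectedComponentMk v ∧
      G.connectedComponentMk u ∈ G.oddComponents ∧
      G.connectedComponentMk v ∈ G.oddComponents := by
  set f : G.ConnectedComponent → G'.ConnectedComponent := ConnectedComponent.map (Hom.ofLE hle)
  set R := {C ∈ G.oddComponents | u ∉ C.supp ∧ v ∉ C.supp}
  have hsupp (C : G.ConnectedComponent) (hu : u ∉ C.supp) (hv : v ∉ C.supp) :
      (f C).supp = C.supp := by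
    induction C using ConnectedComponent.ind with | _ x =>
    ext y
    constructor
    · intro hy
      obtain ⟨p⟩ : G'.Reachable y x := ConnectedComponent.exact hy
      clear hy
      induction p with
      | nil => simp
      | @cons a b c hab p ih =>
        have hb := ih hu hv
        rcases hadj _ _ hab with hab | hab
        · exact (ConnectedComponent.mem_supp_congr_adj _ hab).2 hb
        · rcases Sym2.eq_iff.1 hab with ⟨rfl, rfl⟩ | ⟨rfl, rfl⟩
          · exact absurd hb hv
          · exact absurd hb hu
    · intro hy
      exact ConnectedComponent.sound ((ConnectedComponent.exact hy).mono hle)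
  have hR : R.ncard ≤ G'.oddComponents.ncard := by
    refine Set.ncard_le_ncard_of_injOn f ?_ ?_
    · rintro C ⟨hC, hu, hv⟩
      simpa [hsupp C hu hv] using hC
    · rintro C ⟨-, hu, hv⟩ D ⟨-, hu', hv'⟩ hCD
      apply ConnectedComponent.supp_injective
      rw [← hsupp C hu hv, ← hsupp D hu' hv', hCD]
  have hsub : G.oddComponents ⊆
      R ∪ (G.oddComponents ∩ {G.connectedComponentMk u, G.connectedComponentMk v}) := by
    intro C hC
    by_cases hu : u ∈ C.supp
    · exact .inr ⟨hC, .inl hu.symm⟩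
    by_cases hv : v ∈ C.supp
    · exact .inr ⟨hC, .inr hv.symm⟩
    exact .inl ⟨hC, hu, hv⟩
  have h1 := (Set.ncard_le_ncard hsub).trans (Set.ncard_union_le _ _)
  have h2 := Set.ncard_le_ncard (Set.inter_subset_right (s := G.oddComponents)
    (t := {G.connectedComponentMk u, G.connectedComponentMk v}))
  have hne : G.connectedComponentMk u ≠ G.connectedComponentMk v := fun he => by
    simp only [he, Set.pair_eq_singleton, Set.ncard_singleton] at h1 h2
    omega
  rw [Set.ncard_pair hne] at h2
  have heq := Set.eq_of_subset_of_ncard_le (Set.inter_subset_right (s := G.oddComponents)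
    (t := {G.connectedComponentMk u, G.connectedComponentMk v}))
    (by rw [Set.ncard_pair hne]; omega)
  rw [Set.inter_eq_right] at heq
  exact ⟨by omega, hne, heq (.inl rfl), heq (.inr rfl)⟩

end SimpleGraph

section KExt

variable {V : Type*} [Fintype V] {G : SimpleGraph V} {k : ℕ} {u v : V}

/-- If a graph has a perfect matching avoiding the bridge `uv`, then no perfect matching
contains `uv`. -/
lemma SimpleGraph.IsBridge.not_adj_of_isPerfectMatching
    (hb : G.IsBridge s(u, v)) {Q : (G.deleteEdges {s(u, v)}).Subgraph}
    (hQ : Q.IsPerfectMatching) {P : G.Subgraph} (hP : P.IsPerfectMatching) : ¬ P.Adj u v := by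
  intro huv
  set A := ((G.deleteEdges {s(u, v)}).connectedComponentMk u).supp with hA
  have hvA : v ∉ A := fun h => hb (ConnectedComponent.exact h).symm
  have huA : u ∈ A := rfl
  have heven : Even A.ncard := by
    have h := (hQ.induce_connectedComponent_isMatching
      ((G.deleteEdges {s(u, v)}).connectedComponentMk u)).ncard_verts
    rw [Subgraph.induce_verts, ← hA] at h
    exact h ▸ even_two_mul _
  have hmatch : (P.induce (A \ {u})).IsMatching := by
    rintro a ⟨haA, hau⟩
    obtain ⟨b, hab, hb⟩ := Subgraph.isPerfectMatching_iff.1 hP a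
    have hbu : b ≠ u := by
      rintro rfl
      exact hvA (hP.1.eq_of_adj_left huv hab.symm ▸ haA)
    have hbA : b ∈ A := by
      refine (ConnectedComponent.mem_supp_congr_adj _ ?_).1 haA
      refine deleteEdges_adj.2 ⟨hab.adj_sub, fun h => ?_⟩
      rcases Sym2.eq_iff.1 h with ⟨h, -⟩ | ⟨-, h⟩
      · exact hau h
      · exact hbu h
    exact ⟨b, ⟨⟨haA, hau⟩, ⟨hbA, hbu⟩, hab⟩, fun y hy => hb y hy.2.2⟩
  have h1 := hmatch.ncard_verts
  rw [Subgraph.induce_verts] at h1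
  have h2 := Set.ncard_sdiff_singleton_add_one huA
  rw [h1] at h2
  rw [← h2] at heven
  exact absurd heven (by simp)

namespace SimpleGraph.Subgraph

lemma IsPerfectMatching.two_mul_ncard_edgeSet_s8 {P : G.Subgraph} (hP : P.IsPerfectMatching) :
    2 * P.edgeSet.ncard = Fintype.card V := by
  rw [← hP.1.ncard_verts, hP.2.verts_eq_univ, Set.ncard_univ, Nat.card_eq_fintype_card]

/-- If `G - uv` has a perfect matching with more than `k` edges, then the edge `uv` lies in a
`k`-matching of `G`. -/
lemma IsPerfectMatching.exists_isMatching_adj (hk : 1 ≤ k) (hcard : 2 * (k + 1) ≤ Fintype.card V)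
    (huv : G.Adj u v) {Q : (G.deleteEdges {s(u, v)}).Subgraph} (hQ : Q.IsPerfectMatching) :
    ∃ M : G.Subgraph, M.IsMatching ∧ M.edgeSet.ncard = k ∧ M.Adj u v := by
  obtain ⟨u', hu', hu''⟩ := isPerfectMatching_iff.1 hQ u
  obtain ⟨v', hv', hv''⟩ := isPerfectMatching_iff.1 hQ v
  have hQc := hQ.two_mul_ncard_edgeSet_s8
  have hle : k - 1 ≤ (Q.edgeSet \ {s(u, u'), s(v, v')}).ncard := by
    have h1 := Set.ncard_le_ncard_sdiff_add_ncard Q.edgeSet {s(u, u'), s(v, v')}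
    have h2 := Set.ncard_insert_le (s(u, u')) {s(v, v')}
    rw [Set.ncard_singleton] at h2
    omega
  obtain ⟨F, hFQ, hF⟩ := Set.exists_subset_card_eq hle
  obtain ⟨N, hNQ, hN, rfl, hNv⟩ := hQ.1.exists_le_edgeSet_eq (hFQ.trans Set.sdiff_subset)
  have huN : u ∉ N.verts := fun h => by
    obtain ⟨e, he, w, rfl⟩ := hNv u h
    obtain rfl := hu'' w (hNQ.2 he)
    exact (hFQ he).2 (.inl rfl)
  have hvN : v ∉ N.verts := fun h => by
    obtain ⟨e, he, w, rfl⟩ := hNv v h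
    obtain rfl := hv'' w (hNQ.2 he)
    exact (hFQ he).2 (.inr rfl)
  have hNm := hN.map_ofLE (G.deleteEdges_le {s(u, v)})
  refine ⟨N.map (Hom.ofLE (G.deleteEdges_le {s(u, v)})) ⊔ G.subgraphOfAdj huv,
    hNm.sup (.subgraphOfAdj huv) ?_, ?_, by simp⟩
  · rw [hNm.support_eq_verts, (IsMatching.subgraphOfAdj huv).support_eq_verts,
      Set.disjoint_left]
    rintro _ ⟨x, hx, rfl⟩ (h | h)
    · exact huN ((show x = u from h) ▸ hx)
    · exact hvN ((show x = v from h) ▸ hx)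
  · have huvN : s(u, v) ∉ N.edgeSet := fun h => huN (N.edge_vert h)
    rw [edgeSet_sup, edgeSet_subgraphOfAdj, Set.union_singleton, edgeSet_map]
    have : (Sym2.map (Hom.ofLE (G.deleteEdges_le {s(u, v)}))) = id := Sym2.map_id
    rw [this, Set.image_id, Set.ncard_insert_of_notMem huvN]
    omega

end SimpleGraph.Subgraph

lemma KExt.connected_deleteEdges (hG : KExt G k) (hk : 1 ≤ k)
    (hcard : 2 * (k + 1) ≤ Fintype.card V) (huv : G.Adj u v)
    {Q : (G.deleteEdges {s(u, v)}).Subgraph} (hQ : Q.IsPerfectMatching) :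
    (G.deleteEdges {s(u, v)}).Connected := by
  refine hG.1.connected_delete_edge_of_not_isBridge fun hb => ?_
  obtain ⟨M, hM, hMk, huvM⟩ := hQ.exists_isMatching_adj hk hcard huv
  obtain ⟨P, hP, hMP⟩ := hG.2.2 M hM hMk
  exact hb.not_adj_of_isPerfectMatching hQ hP (hMP.2 huvM)

/-- If deleting `uv` destroys `k`-extendability, some `k`-matching avoiding `uv` is no longer
contained in a perfect matching. -/
lemma KExt.exists_isMatching_of_not_kExt_deleteEdges (hG : KExt G k) (hk : 1 ≤ k)
    (hcard : 2 * (k + 1) ≤ Fintype.card V) (huv : G.Adj u v)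
    (h : ¬ KExt (G.deleteEdges {s(u, v)}) k) :
    ∃ M : (G.deleteEdges {s(u, v)}).Subgraph, M.IsMatching ∧ M.edgeSet.ncard = k ∧
      ¬ ∃ P : (G.deleteEdges {s(u, v)}).Subgraph, P.IsPerfectMatching ∧ M ≤ P := by
  by_contra! hM
  refine h ?_
  suffices hQ : ∃ Q : (G.deleteEdges {s(u, v)}).Subgraph, Q.IsPerfectMatching from
    ⟨hG.connected_deleteEdges hk hcard huv hQ.choose_spec, hQ, hM⟩
  obtain ⟨P, hP⟩ := hG.2.1
  have hPc := hP.two_mul_ncard_edgeSet_s8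
  have hle : k ≤ (P.edgeSet \ {s(u, v)}).ncard := by
    have := Set.pred_ncard_le_ncard_sdiff_singleton P.edgeSet s(u, v)
    omega
  obtain ⟨F, hFP, hF⟩ := Set.exists_subset_card_eq hle
  obtain ⟨N, hNP, hN, rfl, -⟩ := hP.1.exists_le_edgeSet_eq (hFP.trans Set.sdiff_subset)
  let M : (G.deleteEdges {s(u, v)}).Subgraph :=
    { verts := N.verts
      Adj := N.Adj
      adj_sub h := deleteEdges_adj.2 ⟨h.adj_sub, (hFP h).2⟩
      edge_vert h := N.edge_vert h
      symm := N.symm }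
  obtain ⟨Q, hQ, -⟩ := hM M hN hF
  exact ⟨Q, hQ⟩

lemma Admissible.not_kExt_deleteEdges {S : Set V} (hS : Admissible G k u v S) :
    ¬ KExt (G.deleteEdges {s(u, v)}) k := by
  rintro ⟨-, -, hext⟩
  obtain ⟨huS, -, ⟨M, hM, hMS, hMk⟩, hodd, -⟩ := hS
  obtain ⟨F, hFM, hF⟩ := Set.exists_subset_card_eq hMk
  obtain ⟨N, hNM, hN, rfl, -⟩ := hM.exists_le_edgeSet_eq hFM
  let N' : (G.deleteEdges {s(u, v)}).Subgraph :=
    { verts := N.verts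
      Adj := N.Adj
      adj_sub {a b} h := deleteEdges_adj.2 ⟨h.adj_sub, fun he => by
        have ha := hMS (hNM.1 h.fst_mem)
        have hb := hMS (hNM.1 h.snd_mem)
        rcases Sym2.eq_iff.1 he with ⟨rfl, -⟩ | ⟨-, rfl⟩
        · exact huS ha
        · exact huS hb⟩
      edge_vert h := N.edge_vert h
      symm := N.symm }
  have hN' : N'.IsMatching := hN
  have hN'F : N'.edgeSet.ncard = k := hF
  have h1 := (Subgraph.exists_isPerfectMatching_ge_iff hN').1 (hext N' hN' hN'F) S
    (hNM.1.trans hMS)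
  rw [hN'.ncard_verts, hN'F] at h1
  replace hodd : ((G.deleteEdges {s(u, v)}).induce Sᶜ).oddComponents.ncard + 2 * k =
      S.ncard + 2 := hodd
  omega

lemma KExt.exists_admissible (hG : KExt G k) (hk : 1 ≤ k)
    (hcard : 2 * (k + 1) ≤ Fintype.card V) (huv : G.Adj u v)
    (h : ¬ KExt (G.deleteEdges {s(u, v)}) k) : ∃ S : Set V, Admissible G k u v S := by
  obtain ⟨M, hM, hMk, hMP⟩ := hG.exists_isMatching_of_not_kExt_deleteEdges hk hcard huv h
  have hle := G.deleteEdges_le {s(u, v)}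
  set M' := M.map (Hom.ofLE hle)
  have hM' : M'.IsMatching := hM.map_ofLE hle
  have hverts : M'.verts = M.verts := Set.image_id _
  have hMk' : M'.edgeSet.ncard = k := by
    have := hM.ncard_verts
    have := hM'.ncard_verts
    rw [hverts] at this
    omega
  have hext := (Subgraph.exists_isPerfectMatching_ge_iff hM').1 (hG.2.2 M' hM' hMk')
  rw [Subgraph.exists_isPerfectMatching_ge_iff hM] at hMP
  push Not at hMP
  obtain ⟨S, hMS, hlt⟩ := hMP
  have hSG := hext S (hverts ▸ hMS)
  rw [hM'.ncard_verts, hMk'] at hSG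
  rw [hM.ncard_verts, hMk] at hlt
  have hEven : Even (Fintype.card V) := by
    obtain ⟨P, hP⟩ := hG.2.1
    exact hP.two_mul_ncard_edgeSet_s8 ▸ even_two_mul _
  have hparity : Odd ((G.deleteEdges {s(u, v)}).induce Sᶜ).oddComponents.ncard ↔ Odd S.ncard := by
    rw [odd_ncard_oddComponents, Nat.card_coe_set_eq]
    have := Set.ncard_add_ncard_compl S
    rw [Nat.card_eq_fintype_card] at this
    grind
  have hge : S.ncard + 2 ≤
      ((G.deleteEdges {s(u, v)}).induce Sᶜ).oddComponents.ncard + 2 * k := by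
    grind
  have huS : u ∉ S := fun hu => by
    rw [induce_compl_deleteEdges_eq (.inl hu)] at hge
    omega
  have hvS : v ∉ S := fun hv => by
    rw [induce_compl_deleteEdges_eq (.inr hv)] at hge
    omega
  obtain ⟨heq, hne, hu, hv⟩ := odd_components_of_ncard_add_two_le
    (G := (G.deleteEdges {s(u, v)}).induce Sᶜ) (G' := G.induce Sᶜ)
    (u := ⟨u, huS⟩) (v := ⟨v, hvS⟩) (fun a b hab => hle hab)
    (fun a b hab => by
      by_cases h : s(a.1, b.1) = s(u, v)
      · right
        exact Sym2.map.injective Subtype.val_injective h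
      · exact .inl (deleteEdges_adj.2 ⟨hab, h⟩))
    (by omega)
  refine ⟨S, huS, hvS, ⟨M', hM', hverts ▸ hMS, hMk'.ge⟩, ?_, huS, hvS, hne, hu, hv⟩
  change ((G.deleteEdges {s(u, v)}).induce Sᶜ).oddComponents.ncard + 2 * k = S.ncard + 2
  omega

end KExt

theorem stmt8 {V : Type*} [Fintype V] (G : SimpleGraph V) (n k : ℕ)
    (hn : Fintype.card V = 2 * n) (hk : 1 ≤ k) (hkn : k ≤ n - 1)
    (hG : KExt G k) :
    MinimalKExt G k ↔ ∀ u v : V, G.Adj u v → ∃ S : Set V, Admissible G k u v S := by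
  constructor
  · rintro ⟨-, hmin⟩ u v huv
    exact hG.exists_admissible hk (by omega) huv (hmin _ huv)
  · refine fun h => ⟨hG, fun e => ?_⟩
    induction e with | _ u v =>
    intro huv
    obtain ⟨S, hS⟩ := h u v huv
    exact hS.not_kExt_deleteEdges
end

section
/- Let G be a finite simple k-extendable graph (k ≥ 1) and let X be a vertex cut of G such that the induced subgraph G[X] has a perfect matching M with |M| = k. Then every connected component of G − X has an even number of vertices, and every vertex of X has a neighbor in each connected component of G − X. -/
open SimpleGraph

/-- `X` is a vertex cut of `G`: deleting the vertices of `X` leaves a disconnected graph. -/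
def IsVertexCut {V : Type*} (G : SimpleGraph V) (X : Set V) : Prop :=
  ¬ (G.induce Xᶜ).Preconnected

/-- Deleting the two ends of an edge of a matching removes exactly that edge. -/
lemma SimpleGraph.Subgraph.IsMatching.exists_delete_edge {V : Type*} {G : SimpleGraph V}
    {M : G.Subgraph} (hM : M.IsMatching) {x y : V} (hxy : M.Adj x y) :
    ∃ N : G.Subgraph, N.IsMatching ∧ N.verts = M.verts \ {x, y} ∧
      N.edgeSet = M.edgeSet \ {s(x, y)} := by
  refine ⟨M.deleteVerts {x, y}, ?_, rfl, ?_⟩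
  · rintro v ⟨hv, hvn⟩
    obtain ⟨w, hw, hu⟩ := hM hv
    have hwn : w ∉ ({x, y} : Set V) := by
      rintro (rfl | rfl)
      · exact hvn (Or.inr (hM.eq_of_adj_left hw.symm hxy))
      · exact hvn (Or.inl (hM.eq_of_adj_left hw.symm hxy.symm))
    refine ⟨w, ?_, fun z hz => hu z ?_⟩
    · exact Subgraph.deleteVerts_adj.2 ⟨hv, hvn, hw.snd_mem, hwn, hw⟩
    · exact (Subgraph.deleteVerts_adj.1 hz).2.2.2.2
  · ext e
    induction e with
    | _ v w =>
      simp only [Subgraph.mem_edgeSet, Subgraph.deleteVerts_adj, Set.mem_sdiff,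
        Set.mem_singleton_iff, Set.mem_insert_iff, Sym2.eq_iff]
      constructor
      · rintro ⟨-, h1, -, h2, h⟩
        exact ⟨h, by tauto⟩
      · rintro ⟨h, hne⟩
        refine ⟨h.fst_mem, ?_, h.snd_mem, ?_, h⟩
        · rintro (rfl | rfl)
          · exact hne (Or.inl ⟨rfl, hM.eq_of_adj_left h hxy⟩)
          · exact hne (Or.inr ⟨rfl, hM.eq_of_adj_left h hxy.symm⟩)
        · rintro (rfl | rfl)
          · exact hne (Or.inr ⟨hM.eq_of_adj_left h.symm hxy, rfl⟩)
          · exact hne (Or.inl ⟨hM.eq_of_adj_left h.symm hxy.symm, rfl⟩)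

/-- An edge disjoint from a matching can be added to it. -/
lemma SimpleGraph.Subgraph.IsMatching.exists_insert_edge {V : Type*} {G : SimpleGraph V}
    {M : G.Subgraph} (hM : M.IsMatching) {x y : V} (hxy : G.Adj x y)
    (hx : x ∉ M.verts) (hy : y ∉ M.verts) :
    ∃ N : G.Subgraph, N.IsMatching ∧ N.verts = M.verts ∪ {x, y} ∧
      N.edgeSet = insert s(x, y) M.edgeSet := by
  refine ⟨M ⊔ G.subgraphOfAdj hxy, hM.sup (.subgraphOfAdj hxy) ?_, by simp, ?_⟩
  · rw [hM.support_eq_verts, (Subgraph.IsMatching.subgraphOfAdj hxy).support_eq_verts]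
    simp [hx, hy]
  · rw [Subgraph.edgeSet_sup, edgeSet_subgraphOfAdj, Set.union_singleton]

/-- In a `k`-extendable graph, a vertex set that is disjoint from a `k`-matching and whose
neighbours outside the set are all covered by that matching has even size. -/
lemma KExt.even_ncard {V : Type*} [Fintype V] {G : SimpleGraph V} {k : ℕ} (hG : KExt G k)
    {N : G.Subgraph} (hN : N.IsMatching) (hNk : N.edgeSet.ncard = k) {S : Set V}
    (hS : ∀ v ∈ S, v ∉ N.verts)
    (hcl : ∀ v ∈ S, ∀ w, G.Adj v w → w ∈ S ∨ w ∈ N.verts) : Even S.ncard := by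
  classical
  obtain ⟨P, hP, hNP⟩ := hG.2.2 N hN hNk
  have hmatch : (P.induce S).IsMatching := by
    intro v hv
    obtain ⟨w, hw, hu⟩ := hP.1 (hP.2 v)
    refine ⟨w, ⟨hv, ?_, hw⟩, fun z hz => hu z hz.2.2⟩
    refine (hcl v hv w hw.adj_sub).resolve_right fun hwN => ?_
    obtain ⟨u, hwu, -⟩ := hN hwN
    exact hS v hv (hP.1.eq_of_adj_left (hNP.2 hwu) hw.symm ▸ hwu.snd_mem)
  have := Fintype.ofFinite (P.induce S).verts
  have he := hmatch.even_card
  rwa [← Set.ncard_eq_toFinset_card'] at he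

/-- If a matching with `k` edges in a `k`-extendable graph avoids an even set `S` that contains
all neighbours of `S` not covered by the matching, then an end of a matching edge has a
neighbour in `S` as soon as the other end does. -/
lemma KExt.exists_adj_of_adj {V : Type*} [Fintype V] {G : SimpleGraph V} {k : ℕ}
    (hG : KExt G k) {M : G.Subgraph} (hM : M.IsMatching) (hMk : M.edgeSet.ncard = k)
    {S : Set V} (hS : ∀ v ∈ S, v ∉ M.verts)
    (hcl : ∀ v ∈ S, ∀ w, G.Adj v w → w ∈ S ∨ w ∈ M.verts) {x y : V} (hxy : M.Adj x y)
    (hy : ∃ c ∈ S, G.Adj y c) : ∃ c ∈ S, G.Adj x c := by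
  by_contra! hx
  obtain ⟨c, hc, hyc⟩ := hy
  obtain ⟨M₁, hM₁, hv₁, he₁⟩ := hM.exists_delete_edge hxy
  obtain ⟨N, hN, hv, he⟩ := hM₁.exists_insert_edge hyc (by simp [hv₁]) (by simp [hv₁, hS c hc])
  have hcard : N.edgeSet.ncard = k := by
    have hmem : s(y, c) ∉ M₁.edgeSet := fun h => by
      have := Subgraph.Adj.snd_mem (Subgraph.mem_edgeSet.1 h)
      simp [hv₁, hS c hc] at this
    rw [he, Set.ncard_insert_of_notMem hmem, he₁, ← hMk]
    exact Set.ncard_sdiff_singleton_add_one (Subgraph.mem_edgeSet.2 hxy)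
  have h1 : Even S.ncard := hG.even_ncard hM hMk hS hcl
  have h2 : Even (S \ {c}).ncard := by
    refine hG.even_ncard hN hcard ?_ ?_
    · rintro v ⟨hvS, hvc⟩ hvN
      have hyM := hxy.snd_mem
      have := hS v hvS
      simp only [hv, hv₁, Set.mem_union, Set.mem_sdiff, Set.mem_insert_iff,
        Set.mem_singleton_iff] at *
      grind
    · rintro v ⟨hvS, hvc⟩ w hvw
      have := hcl v hvS w hvw
      have hwx : w ≠ x := by rintro rfl; exact hx v hvS hvw.symm
      simp only [hv, hv₁, Set.mem_union, Set.mem_sdiff, Set.mem_insert_iff,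
        Set.mem_singleton_iff] at *
      grind
  have := Set.ncard_sdiff_singleton_add_one hc
  grind

/-- If a matching with `k` edges in a `k`-extendable graph avoids a set `S` that contains all
neighbours of `S` not covered by the matching, then there is no configuration consisting of a
matching edge `ab` with no neighbours in `S`, a matching edge `xy`, a neighbour of `x` in `S`, and
a neighbour `d` of `y` outside `S` that is not covered by the other matching edges. -/
lemma KExt.false_of_adj {V : Type*} [Fintype V] {G : SimpleGraph V} {k : ℕ}
    (hG : KExt G k) {M : G.Subgraph} (hM : M.IsMatching) (hMk : M.edgeSet.ncard = k)
    {S : Set V} (hS : ∀ v ∈ S, v ∉ M.verts)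
    (hcl : ∀ v ∈ S, ∀ w, G.Adj v w → w ∈ S ∨ w ∈ M.verts) {a b x y c d : V}
    (hab : M.Adj a b) (ha : ∀ c ∈ S, ¬ G.Adj a c) (hb : ∀ c ∈ S, ¬ G.Adj b c)
    (hxy : M.Adj x y) (hc : c ∈ S) (hxc : G.Adj x c) (hyd : G.Adj y d) (hd : d ∉ S)
    (hdx : d ≠ x) (hdM : d ∈ M.verts → d = a) : False := by
  have hxa : x ≠ a := by rintro rfl; exact ha c hc hxc
  have hxb : x ≠ b := by rintro rfl; exact hb c hc hxc
  have hya : y ≠ a := by rintro rfl; exact hxb (hM.eq_of_adj_left hxy.symm hab)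
  have hyb : y ≠ b := by rintro rfl; exact hxa (hM.eq_of_adj_left hxy.symm hab.symm)
  have hcM := hS c hc
  have hyM := hxy.snd_mem
  have hcd : c ≠ d := by rintro rfl; exact hd hc
  have hyc : y ≠ c := by rintro rfl; exact hcM hyM
  obtain ⟨M₁, hM₁, hv₁, he₁⟩ := hM.exists_delete_edge hab
  have hxy₁ : M₁.Adj x y := by
    rw [← Subgraph.mem_edgeSet, he₁]
    exact ⟨hxy, by simp [hxa, hxb]⟩
  obtain ⟨M₂, hM₂, hv₂, he₂⟩ := hM₁.exists_delete_edge hxy₁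
  have hc₂ : c ∉ M₂.verts := by simp [hv₂, hv₁, hcM]
  obtain ⟨M₃, hM₃, hv₃, he₃⟩ := hM₂.exists_insert_edge hxc (by simp [hv₂]) hc₂
  have hd₃ : d ∉ M₃.verts := by
    simp only [hv₃, hv₂, hv₁, Set.mem_union, Set.mem_sdiff, Set.mem_insert_iff,
      Set.mem_singleton_iff]
    grind
  have hy₃ : y ∉ M₃.verts := by
    simp [hv₃, hv₂, hyc, hxy.adj_sub.ne']
  obtain ⟨N, hN, hv, he⟩ := hM₃.exists_insert_edge hyd hy₃ hd₃
  have hcard : N.edgeSet.ncard = k := by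
    have hmem₂ : s(x, c) ∉ M₂.edgeSet := fun h => hc₂ (Subgraph.mem_edgeSet.1 h).snd_mem
    have hmem₃ : s(y, d) ∉ M₃.edgeSet := fun h => hd₃ (Subgraph.mem_edgeSet.1 h).snd_mem
    have h₁ := Set.ncard_sdiff_singleton_add_one (Subgraph.mem_edgeSet.2 hab)
    have h₂ := Set.ncard_sdiff_singleton_add_one (Subgraph.mem_edgeSet.2 hxy₁)
    rw [he, Set.ncard_insert_of_notMem hmem₃, he₃, Set.ncard_insert_of_notMem hmem₂, he₂]
    rw [← he₁] at h₁
    omega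
  have h1 : Even S.ncard := hG.even_ncard hM hMk hS hcl
  have h2 : Even (S \ {c}).ncard := by
    refine hG.even_ncard hN hcard ?_ ?_
    · rintro v ⟨hvS, hvc⟩ hvN
      have := hS v hvS
      have hxM := hxy.fst_mem
      simp only [hv, hv₃, hv₂, hv₁, Set.mem_union, Set.mem_sdiff, Set.mem_insert_iff,
        Set.mem_singleton_iff] at *
      grind
    · rintro v ⟨hvS, hvc⟩ w hvw
      have := hcl v hvS w hvw
      have hwa : w ≠ a := by rintro rfl; exact ha v hvS hvw.symm
      have hwb : w ≠ b := by rintro rfl; exact hb v hvS hvw.symm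
      simp only [hv, hv₃, hv₂, hv₁, Set.mem_union, Set.mem_sdiff, Set.mem_insert_iff,
        Set.mem_singleton_iff] at *
      grind
  have := Set.ncard_sdiff_singleton_add_one hc
  grind

/-- If a matching with `k` edges in a `k`-extendable graph avoids a nonempty set `S` that contains
all neighbours of `S` not covered by the matching, then every vertex covered by the matching has a
neighbour in `S`. -/
lemma KExt.exists_adj_mem {V : Type*} [Fintype V] {G : SimpleGraph V} {k : ℕ}
    (hG : KExt G k) {M : G.Subgraph} (hM : M.IsMatching) (hMk : M.edgeSet.ncard = k)
    {S : Set V} (hS : ∀ v ∈ S, v ∉ M.verts) (hne : S.Nonempty)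
    (hcl : ∀ v ∈ S, ∀ w, G.Adj v w → w ∈ S ∨ w ∈ M.verts) {a : V} (haM : a ∈ M.verts) :
    ∃ c ∈ S, G.Adj a c := by
  by_contra ha
  have hpair {u v : V} (huv : M.Adj u v) (hv : ∃ c ∈ S, G.Adj v c) : ∃ c ∈ S, G.Adj u c :=
    hG.exists_adj_of_adj hM hMk hS hcl huv hv
  let T : Set V := S ∪ {v | v ∈ M.verts ∧ ∃ c ∈ S, G.Adj v c}
  obtain ⟨s, hs⟩ := hne
  have haT : a ∉ T := by
    rintro (h | h)
    · exact hS a h haM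
    · exact ha h.2
  obtain ⟨p⟩ := hG.1.preconnected s a
  obtain ⟨e, -, hy, hd⟩ := p.exists_boundary_dart T (Or.inl hs) haT
  obtain ⟨⟨y, d⟩, hyd⟩ := e
  simp only at hy hd hyd
  have hdS : d ∉ S := fun h => hd (Or.inl h)
  obtain ⟨hyM, hyS⟩ : y ∈ M.verts ∧ ∃ c ∈ S, G.Adj y c := by
    refine hy.resolve_left fun hyS => hd (Or.inr ⟨?_, y, hyS, hyd.symm⟩)
    exact (hcl y hyS d hyd).resolve_left hdS
  obtain ⟨x, hyx, -⟩ := hM hyM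
  obtain ⟨c, hc, hxc⟩ := hpair hyx.symm hyS
  have hdx : d ≠ x := by
    rintro rfl
    exact hd (Or.inr ⟨hyx.snd_mem, c, hc, hxc⟩)
  obtain ⟨a', haM', ha', hda⟩ :
      ∃ a' ∈ M.verts, (¬ ∃ c ∈ S, G.Adj a' c) ∧ (d ∈ M.verts → d = a') := by
    by_cases hdM : d ∈ M.verts
    · exact ⟨d, hdM, fun h => hd (Or.inr ⟨hdM, h⟩), fun _ => rfl⟩
    · exact ⟨a, haM, ha, fun h => absurd h hdM⟩
  obtain ⟨b, hab, -⟩ := hM haM'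
  exact hG.false_of_adj hM hMk hS hcl hab (fun c hc h => ha' ⟨c, hc, h⟩)
    (fun c hc h => ha' (hpair hab ⟨c, hc, h⟩)) hyx.symm hc hxc hyd hdS hdx hda

theorem stmt12 {V : Type*} [Fintype V] (G : SimpleGraph V) (k : ℕ) (hk : 1 ≤ k)
    (hG : KExt G k) (X : Set V) (hcut : IsVertexCut G X)
    (M : G.Subgraph) (hM : M.IsMatching) (hMX : M.verts = X)
    (hMk : M.edgeSet.ncard = k) :
    (∀ C : (G.induce Xᶜ).ConnectedComponent, Even C.supp.ncard) ∧
    ∀ x ∈ X, ∀ C : (G.induce Xᶜ).ConnectedComponent,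
      ∃ y, ∃ (hy : y ∈ Xᶜ), G.Adj x y ∧
        (G.induce Xᶜ).connectedComponentMk ⟨y, hy⟩ = C := by
  subst hMX
  have hS (C : (G.induce M.vertsᶜ).ConnectedComponent) :
      ∀ v ∈ Subtype.val '' C.supp, v ∉ M.verts := by
    rintro _ ⟨v, -, rfl⟩
    exact v.2
  have hcl (C : (G.induce M.vertsᶜ).ConnectedComponent) :
      ∀ v ∈ Subtype.val '' C.supp, ∀ w, G.Adj v w →
        w ∈ Subtype.val '' C.supp ∨ w ∈ M.verts := by
    rintro _ ⟨v, hv, rfl⟩ w hvw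
    by_cases hw : w ∈ M.verts
    · exact Or.inr hw
    · refine Or.inl ⟨⟨w, hw⟩, ?_, rfl⟩
      exact C.mem_supp_of_adj_mem_supp hv hvw
  refine ⟨fun C => ?_, fun x hx C => ?_⟩
  · rw [← Set.ncard_image_of_injective _ Subtype.val_injective]
    exact hG.even_ncard hM hMk (hS C) (hcl C)
  · obtain ⟨_, ⟨⟨y, hy⟩, hyC, rfl⟩, hxy⟩ :=
      hG.exists_adj_mem hM hMk (hS C) (C.nonempty_supp.image _) (hcl C) hx
    exact ⟨y, hy, hxy, hyC⟩
end

section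
/- Let G be a finite simple minimal k-extendable graph (k ≥ 1), let e = uv be an edge of G, and let S_e ⊆ V(G)∖{u,v} be a set such that: G[S_e] has a matching of size at least k; the number of odd components of G_e := G − e − S_e equals |S_e| − 2k + 2; and u and v belong to two distinct odd components of G_e. Let M be a matching of G[S_e] with |M| = k. Then every perfect matching of G − V(M) contains the edge e. -/
open SimpleGraph

/-- A fixed-point-free involution on a finite set forces even cardinality. -/
theorem Set.even_ncard_of_involution {α : Type*} [Finite α] (s : Set α) (g : α → α)
    (hmem : ∀ a ∈ s, g a ∈ s) (hne : ∀ a ∈ s, g a ≠ a) (hinv : ∀ a ∈ s, g (g a) = a) :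
    Even s.ncard := by
  classical
  have := Fintype.ofFinite α
  have hsum : ∑ _a ∈ s.toFinset, (1 : ZMod 2) = 0 :=
    Finset.sum_involution (fun a _ => g a) (fun _ _ => by decide)
      (fun a ha _ => hne a (by simpa using ha)) (fun a ha => by simpa using hmem a (by simpa using ha))
      (fun a ha => hinv a (by simpa using ha))
  rw [Set.ncard_eq_toFinset_card']
  simpa [ZMod.natCast_eq_zero_iff_even] using hsum

/-- A matching covers twice as many vertices as it has edges. -/
theorem SimpleGraph.Subgraph.IsMatching.ncard_verts_s13 {V : Type*} [Finite V] {G : SimpleGraph V}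
    {M : G.Subgraph} (hM : M.IsMatching) : M.verts.ncard = 2 * M.edgeSet.ncard := by
  classical
  have := Fintype.ofFinite V
  have hsum := M.spanningCoe.sum_degrees_eq_twice_card_edges
  have hdeg (x : V) : M.spanningCoe.degree x = if x ∈ M.verts then 1 else 0 := by
    rw [Subgraph.degree_spanningCoe]
    split_ifs with hx
    · exact (Subgraph.isMatching_iff_forall_degree.mp hM) x hx
    · exact Subgraph.degree_of_notMem_verts hx
  have hedge : M.spanningCoe.edgeFinset.card = M.edgeSet.ncard := by
    rw [← Subgraph.edgeSet_spanningCoe, Set.ncard_eq_toFinset_card']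
    rfl
  rw [← hedge, ← hsum, Set.ncard_eq_toFinset_card']
  simp_rw [hdeg, Finset.sum_boole, Nat.cast_id]
  congr 1
  ext x
  simp

theorem stmt13 {V : Type*} [Fintype V] (G : SimpleGraph V) (k : ℕ) (hk : 1 ≤ k)
    (hmin : MinimalKExt G k) (u v : V) (huv : G.Adj u v)
    (S : Set V) (hS : Admissible G k u v S)
    (M : G.Subgraph) (hM : M.IsMatching) (hMS : M.verts ⊆ S)
    (hMk : M.edgeSet.ncard = k) :
    ∀ (hu : u ∈ M.vertsᶜ) (hv : v ∈ M.vertsᶜ),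
      ∀ P : (G.induce M.vertsᶜ).Subgraph, P.IsPerfectMatching →
        P.Adj ⟨u, hu⟩ ⟨v, hv⟩ := by
  intro hu hv P hP
  by_contra hadj
  obtain ⟨huS, -, -, hcard, -⟩ := hS
  have : Nonempty ↑(Sᶜ) := ⟨⟨u, huS⟩⟩
  choose f hf hfu using fun x => hP.1 (hP.2 x)
  have hinv (x) : f (f x) = x := (hfu _ _ (hf x).symm).symm
  have hpartner (C : (Ge G u v S).ConnectedComponent) (hC : Odd C.supp.ncard) :
      ∃ x : ↑(Sᶜ), x ∈ C.supp ∧ (f ⟨x, fun h => x.2 (hMS h)⟩ : V) ∈ S := by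
    by_contra! hno
    have hstay (x : ↑(Sᶜ)) (hx : x ∈ C.supp) :
        ∃ y ∈ C.supp, (y : V) = f ⟨x, fun h => x.2 (hMS h)⟩ := by
      refine ⟨⟨_, hno x hx⟩, ?_, rfl⟩
      refine (ConnectedComponent.mem_supp_congr_adj C ?_).mp hx
      have hxf := hf ⟨x, fun h => x.2 (hMS h)⟩
      simp only [Ge, comap_adj, Function.Embedding.subtype_apply, deleteEdges_adj,
        Set.mem_singleton_iff]
      refine ⟨P.adj_sub hxf, fun heq => hadj ?_⟩
      rcases Sym2.eq_iff.mp heq with ⟨h₁, h₂⟩ | ⟨h₁, h₂⟩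
      · have hxu : (⟨x, fun h => x.2 (hMS h)⟩ : ↑(M.vertsᶜ)) = ⟨u, hu⟩ := Subtype.ext h₁
        rw [← hxu, show (⟨v, hv⟩ : ↑(M.vertsᶜ)) = f _ from Subtype.ext h₂.symm]
        exact hxf
      · have hxv : (⟨x, fun h => x.2 (hMS h)⟩ : ↑(M.vertsᶜ)) = ⟨v, hv⟩ := Subtype.ext h₁
        rw [← hxv, show (⟨u, hu⟩ : ↑(M.vertsᶜ)) = f _ from Subtype.ext h₂.symm]
        exact hxf.symm
    choose! g hg hgf using hstay
    refine Nat.not_even_iff_odd.mpr hC (Set.even_ncard_of_involution C.supp g hg ?_ ?_)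
    · intro x hx heq
      have hfix := hgf x hx
      rw [heq] at hfix
      exact (hf ⟨x, fun h => x.2 (hMS h)⟩).ne (Subtype.ext hfix)
    · intro x hx
      apply Subtype.ext
      rw [hgf _ (hg x hx)]
      have : (⟨g x, fun h => (g x).2 (hMS h)⟩ : ↑(M.vertsᶜ)) = f ⟨x, fun h => x.2 (hMS h)⟩ :=
        Subtype.ext (hgf x hx)
      rw [this, hinv]
  choose! r hr hrS using hpartner
  have hle : Set.ncard {C : (Ge G u v S).ConnectedComponent | Odd C.supp.ncard} ≤
      (S \ M.verts).ncard := by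
    refine Set.ncard_le_ncard_of_injOn (fun C => (f ⟨r C, fun h => (r C).2 (hMS h)⟩ : V))
      (fun C hC => ⟨hrS C hC, (f _).2⟩) ?_ (Set.toFinite _)
    intro C hC D hD heq
    have hrr := congrArg f (Subtype.ext heq)
    rw [hinv, hinv] at hrr
    have hCD : r C = r D := Subtype.ext (Subtype.mk.inj hrr)
    have h₁ := hr C hC
    rw [hCD, ConnectedComponent.mem_supp_iff] at h₁
    exact h₁.symm.trans (hr D hD)
  have hdiff := Set.ncard_sdiff_add_ncard_of_subset hMS (Set.toFinite _)
  rw [hM.ncard_verts_s13, hMk] at hdiff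
  omega
end
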